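/- Let Φ: ℝ → ℂ be infinitely differentiable with compact support contained in (0,∞), let T > 0 be real, let c be a positive integer, let h be an integer with gcd(h,c)=1, and let h̄ be any integer with h·h̄ ≡ 1 (mod c). Then for every σ > 0, ∑_{m=1}^∞ (τ(m,2T)/m) e(mh/c) Φ(m) = ζ(1+4iT) c^{−1−4iT} ∫₀^∞ Φ(x) x^{2iT−1} dx + ζ(1−4iT) c^{−1+4iT} ∫₀^∞ Φ(x) x^{−2iT−1} dx + (1/c) ∑_{b=1}^∞ τ(b,2T) [ e(b h̄/c) Φ̌⁺(b/c², T) + e(−b h̄/c) Φ̌⁻(b/c², T) ], where Φ̌^±(x,T) := (1/(2πi)) ∫_{(σ)} G_2^±(s) Φ̃(−s) x^{−s} ds, ζ is the Riemann zeta function, and the sum over b converges absolutely. -/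

import Mathlib

open MeasureTheory Set

/-- `e(x) = exp(2πix)`. -/
noncomputable def e (x : ℂ) : ℂ := Complex.exp (2 * Real.pi * Complex.I * x)

/-- `τ(m,2T) = ∑_{ab=m} (a/b)^{2iT}`, summing over ordered factorizations `m = a·b`. -/
noncomputable def tauT (m : ℕ) (T : ℝ) : ℂ :=
  ∑ d ∈ m.divisors, (((d : ℂ)) / ((m / d : ℕ) : ℂ)) ^ (2 * (T : ℂ) * Complex.I)

/-- Mellin transform `Φ̃(s) = ∫₀^∞ Φ(x) x^{s−1} dx`. -/
noncomputable def mellinT (Φ : ℝ → ℂ) (s : ℂ) : ℂ :=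
  ∫ x in Ioi (0 : ℝ), Φ x * (x : ℂ) ^ (s - 1)

/-- Vertical line integral `(1/(2πi)) ∫_{(σ)} f(s) ds = (1/(2π)) ∫_ℝ f(σ+iu) du`. -/
noncomputable def VI (σ : ℝ) (f : ℂ → ℂ) : ℂ :=
  ((1 / (2 * Real.pi) : ℝ) : ℂ) * ∫ u : ℝ, f (σ + u * Complex.I)

/-- `G_2^+(s) = 2(2π)^{−2s} Γ(s−2iT) Γ(s+2iT) cosh(2πT)`. -/
noncomputable def G2p (T : ℝ) (s : ℂ) : ℂ :=
  2 * ((2 * Real.pi : ℝ) : ℂ) ^ (-2 * s) * Complex.Gamma (s - 2 * T * Complex.I) *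
    Complex.Gamma (s + 2 * T * Complex.I) * Complex.cosh (2 * Real.pi * T)

/-- `G_2^−(s) = 2(2π)^{−2s} Γ(s−2iT) Γ(s+2iT) cos(πs)`. -/
noncomputable def G2m (T : ℝ) (s : ℂ) : ℂ :=
  2 * ((2 * Real.pi : ℝ) : ℂ) ^ (-2 * s) * Complex.Gamma (s - 2 * T * Complex.I) *
    Complex.Gamma (s + 2 * T * Complex.I) * Complex.cos (Real.pi * s)

/-- `Φ̌⁺(x,T) = (1/(2πi)) ∫_{(σ)} G_2^+(s) Φ̃(−s) x^{−s} ds`. -/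
noncomputable def checkPlus (Φ : ℝ → ℂ) (σ : ℝ) (x : ℝ) (T : ℝ) : ℂ :=
  VI σ (fun s => G2p T s * mellinT Φ (-s) * (x : ℂ) ^ (-s))

/-- `Φ̌⁻(x,T) = (1/(2πi)) ∫_{(σ)} G_2^−(s) Φ̃(−s) x^{−s} ds`. -/
noncomputable def checkMinus (Φ : ℝ → ℂ) (σ : ℝ) (x : ℝ) (T : ℝ) : ℂ :=
  VI σ (fun s => G2m T s * mellinT Φ (-s) * (x : ℂ) ^ (-s))

namespace Voronoi

open Complex Filter Topology

section Contour

lemma integrable_const_div_one_add_sq (C : ℝ) : Integrable (fun u : ℝ => C / (1 + u ^ 2)) := by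
  simpa [div_eq_mul_inv] using integrable_inv_one_add_sq.const_mul C

lemma integrable_vertical {f : ℂ → ℂ} {a b C σ : ℝ} (h1 : a ≤ σ) (h2 : σ ≤ b)
    (hf : ∀ s : ℂ, a ≤ s.re → s.re ≤ b → DifferentiableAt ℂ f s)
    (hC : ∀ s : ℂ, a ≤ s.re → s.re ≤ b → ‖f s‖ ≤ C / (1 + s.im ^ 2)) :
    Integrable (fun u : ℝ => f (σ + u * I)) := by
  refine (integrable_const_div_one_add_sq C).mono' ?_ (ae_of_all _ fun u => ?_)
  · refine Continuous.aestronglyMeasurable (continuous_iff_continuousAt.2 fun u => ?_)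
    have hc := (hf (σ + u * I) (by simpa) (by simpa)).continuousAt
    exact ContinuousAt.comp (f := fun u : ℝ => (σ + u * I : ℂ)) hc (by fun_prop)
  · simpa using hC (σ + u * I) (by simpa) (by simpa)

/-- Shifting a vertical line of integration across a strip of holomorphy. -/
lemma integral_vertical_eq {f : ℂ → ℂ} {a b C : ℝ} (hab : a ≤ b)
    (hf : ∀ s : ℂ, a ≤ s.re → s.re ≤ b → DifferentiableAt ℂ f s)
    (hC : ∀ s : ℂ, a ≤ s.re → s.re ≤ b → ‖f s‖ ≤ C / (1 + s.im ^ 2)) :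
    ∫ u : ℝ, f (a + u * I) = ∫ u : ℝ, f (b + u * I) := by
  have ia := integrable_vertical le_rfl hab hf hC
  have ib := integrable_vertical hab le_rfl hf hC
  have ta := intervalIntegral_tendsto_integral ia tendsto_neg_atTop_atBot tendsto_id
  have tb := intervalIntegral_tendsto_integral ib tendsto_neg_atTop_atBot tendsto_id
  have hor : ∀ ε : ℝ, ε = 1 ∨ ε = -1 →
      Tendsto (fun Y : ℝ => ∫ x : ℝ in a..b, f (x + (ε * Y : ℝ) * I)) atTop (𝓝 0) := by
    intro ε hε
    have hε2 : ε ^ 2 = 1 := by rcases hε with rfl | rfl <;> norm_num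
    have hlim : Tendsto (fun Y : ℝ => C / (1 + Y ^ 2) * |b - a|) atTop (𝓝 0) := by
      have : Tendsto (fun Y : ℝ => C / (1 + Y ^ 2)) atTop (𝓝 0) :=
        tendsto_const_nhds.div_atTop
          (tendsto_atTop_add_const_left _ _ (tendsto_pow_atTop two_ne_zero))
      simpa using this.mul_const |b - a|
    refine squeeze_zero_norm (fun Y => ?_) hlim
    refine intervalIntegral.norm_integral_le_of_norm_le_const fun x hx => ?_
    rw [uIoc_of_le hab] at hx
    have := hC (x + (ε * Y : ℝ) * I) (by simpa using hx.1.le) (by simpa using hx.2)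
    simpa [mul_pow, hε2] using this
  have h1 := hor 1 (Or.inl rfl)
  have h2 := hor (-1) (Or.inr rfl)
  have key : ∀ Y : ℝ, 0 ≤ Y →
      (∫ x : ℝ in a..b, f (x + (-1 * Y : ℝ) * I)) - (∫ x : ℝ in a..b, f (x + (1 * Y : ℝ) * I)) +
      I * (∫ y : ℝ in (-Y)..Y, f (b + y * I)) - I * (∫ y : ℝ in (-Y)..Y, f (a + y * I)) = 0 := by
    intro Y hY
    have := integral_boundary_rect_eq_zero_of_differentiableOn f (a + (-Y : ℝ) * I)
      (b + (Y : ℝ) * I) (fun s hs => by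
        rw [mem_reProdIm] at hs
        have h := hs.1
        simp only [add_re, ofReal_re, mul_re, I_re, mul_zero, ofReal_im, I_im, mul_one, sub_self,
          add_zero, uIcc_of_le hab] at h
        exact (hf s h.1 h.2).differentiableWithinAt)
    simpa using this
  have hlim := (((h2.sub h1).add (tb.const_mul I)).sub (ta.const_mul I))
  have h0 : Tendsto (fun _ : ℝ => (0 : ℂ)) atTop (𝓝 0) := tendsto_const_nhds
  have := tendsto_nhds_unique (hlim.congr' (by
    filter_upwards [eventually_ge_atTop 0] with Y hY using key Y hY)) h0
  have h3 : I * ((∫ u : ℝ, f (b + u * I)) - ∫ u : ℝ, f (a + u * I)) = 0 := by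
    linear_combination this
  rcases mul_eq_zero.1 h3 with h | h
  · exact absurd h I_ne_zero
  · exact (sub_eq_zero.1 h).symm

/-- A bound valid high up in a strip extends to the whole strip by compactness. -/
lemma exists_bound_strip {f : ℂ → ℂ} {a b C U : ℝ}
    (hf : ∀ s : ℂ, a ≤ s.re → s.re ≤ b → DifferentiableAt ℂ f s)
    (hC : ∀ s : ℂ, a ≤ s.re → s.re ≤ b → U ≤ |s.im| → ‖f s‖ ≤ C / (1 + s.im ^ 2)) :
    ∃ C' : ℝ, ∀ s : ℂ, a ≤ s.re → s.re ≤ b → ‖f s‖ ≤ C' / (1 + s.im ^ 2) := by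
  have hK : IsCompact (Icc a b ×ℂ Icc (-U) U) := isCompact_Icc.reProdIm isCompact_Icc
  obtain ⟨M, hM⟩ := hK.exists_bound_of_continuousOn (f := f) (fun s hs =>
    (hf s hs.1.1 hs.1.2).continuousAt.continuousWithinAt)
  refine ⟨max C (|M| * (1 + U ^ 2)), fun s h1 h2 => ?_⟩
  have hpos : 0 < 1 + s.im ^ 2 := by positivity
  rcases le_total U |s.im| with h | h
  · exact (hC s h1 h2 h).trans (by gcongr; exact le_max_left _ _)
  · rw [le_div_iff₀ hpos]
    have h3 := hM s ⟨⟨h1, h2⟩, abs_le.1 h⟩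
    have h4 : s.im ^ 2 ≤ U ^ 2 := sq_le_sq' (by linarith [(abs_le.1 h).1]) (abs_le.1 h).2
    calc ‖f s‖ * (1 + s.im ^ 2) ≤ |M| * (1 + U ^ 2) := by
          gcongr; exact h3.trans (le_abs_self M)
      _ ≤ _ := le_max_right _ _

/-- The auxiliary kernel `2β / ((2β - z) z)`. -/
noncomputable def poleKernel (β : ℝ) (z : ℂ) : ℂ := 2 * β / ((2 * β - z) * z)

lemma integral_inv_sq_add_sq {β : ℝ} (hβ : 0 < β) :
    ∫ y : ℝ, 2 * β / (β ^ 2 + y ^ 2) = 2 * Real.pi := by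
  have h := Measure.integral_comp_mul_left (fun y : ℝ => (1 + y ^ 2)⁻¹) β⁻¹
  rw [integral_univ_inv_one_add_sq, inv_inv, abs_of_pos hβ, smul_eq_mul] at h
  have : (fun y : ℝ => 2 * β / (β ^ 2 + y ^ 2)) = fun y => (2 / β) * (1 + (β⁻¹ * y) ^ 2)⁻¹ := by
    ext y; field_simp
  rw [this, integral_const_mul, h]; field_simp

lemma integral_poleKernel_right {β : ℝ} (hβ : 0 < β) :
    ∫ y : ℝ, poleKernel β (β + y * I) = 2 * Real.pi := by
  have : ∀ y : ℝ, poleKernel β (β + y * I) = ((2 * β / (β ^ 2 + y ^ 2) : ℝ) : ℂ) := by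
    intro y
    rw [poleKernel]
    push_cast
    congr 1
    linear_combination (-(y : ℂ) ^ 2) * I_sq
  simp_rw [this]
  rw [integral_complex_ofReal, integral_inv_sq_add_sq hβ]
  simp

lemma norm_poleKernel_le {β x : ℝ} (hβ : 0 < β) {z : ℂ} (hx : x < 0) (hz : z.re ≤ x) :
    ‖poleKernel β z‖ ≤ 2 * β / (x ^ 2 + z.im ^ 2) := by
  have h1 : x ^ 2 + z.im ^ 2 ≤ ‖z‖ ^ 2 := by
    rw [Complex.sq_norm, normSq_apply]; nlinarith
  have h2 : ‖z‖ ≤ ‖2 * β - z‖ := by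
    rw [← sq_le_sq₀ (norm_nonneg _) (norm_nonneg _), Complex.sq_norm, Complex.sq_norm,
      normSq_apply, normSq_apply]
    simp; nlinarith
  have h3 : ‖(2 * β : ℂ)‖ = 2 * β := by simp [abs_of_pos hβ]
  rw [poleKernel, norm_div, h3, norm_mul]
  have : 0 < x ^ 2 := by nlinarith
  gcongr
  calc _ ≤ ‖z‖ ^ 2 := h1
    _ = ‖z‖ * ‖z‖ := sq _
    _ ≤ _ := by gcongr

lemma integral_poleKernel_left {β α : ℝ} (hβ : 0 < β) (hα : α < 0) :
    ∫ y : ℝ, poleKernel β (α + y * I) = 0 := by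
  have hconst : ∀ x ≤ α, ∫ y : ℝ, poleKernel β (x + y * I) = ∫ y : ℝ, poleKernel β (α + y * I) := by
    intro x hx
    refine integral_vertical_eq (C := 2 * β / min 1 (α ^ 2)) hx (fun s _ h2 => ?_)
      (fun s _ h2 => ?_)
    · have h3 : s ≠ 0 := by rintro rfl; simp at h2; linarith
      have h4 : (2 * β - s : ℂ) ≠ 0 := by
        intro h; have := congrArg re h; simp at this; linarith
      unfold poleKernel
      fun_prop (disch := exact mul_ne_zero h4 h3)
    · refine (norm_poleKernel_le hβ hα h2).trans ?_
      have hα2 : 0 < α ^ 2 := by nlinarith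
      rw [div_div]
      have hm : 0 < min 1 (α ^ 2) := lt_min one_pos hα2
      gcongr
      nlinarith [min_le_left 1 (α ^ 2), min_le_right 1 (α ^ 2), sq_nonneg s.im]
  have hbd : ∀ x ≤ α, ‖∫ y : ℝ, poleKernel β (α + y * I)‖ ≤ β / (-x) * (2 * Real.pi) := by
    intro x hx
    rw [← hconst x hx, ← integral_inv_sq_add_sq (β := -x) (by linarith), ← integral_const_mul]
    refine norm_integral_le_of_norm_le ?_ (ae_of_all _ fun y => ?_)
    · by_contra h
      have h1 := integral_inv_sq_add_sq (β := -x) (by linarith)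
      have h2 := integral_undef h
      rw [integral_const_mul, h1] at h2
      have : 0 < β / (-x) * (2 * Real.pi) := by
        have : 0 < -x := by linarith
        positivity
      linarith
    · refine (norm_poleKernel_le hβ (x := x) (by linarith) (by simp)).trans (le_of_eq ?_)
      have : (-x) ^ 2 + y ^ 2 ≠ 0 := by
        have : 0 < (-x) ^ 2 := by nlinarith
        positivity
      simp only [add_im, ofReal_im, mul_im, ofReal_re, I_im, mul_one, I_re, mul_zero, add_zero,
        zero_add, neg_sq] at this ⊢
      have hx1 : x ≠ 0 := by linarith
      field_simp
  have hlim : Tendsto (fun x : ℝ => β / (-x) * (2 * Real.pi)) atBot (𝓝 0) := by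
    have : Tendsto (fun x : ℝ => β / (-x)) atBot (𝓝 0) :=
      tendsto_const_nhds.div_atTop tendsto_neg_atBot_atTop
    simpa using this.mul_const (2 * Real.pi)
  have := ge_of_tendsto hlim ((eventually_le_atBot α).mono hbd)
  exact norm_le_zero_iff.1 this

/-- The residue theorem for a simple pole between two vertical lines. -/
lemma integral_vertical_sub_eq_residue {H : ℂ → ℂ} (hH : Differentiable ℂ H) {a b C : ℝ} {p : ℂ}
    (ha : a < p.re) (hb : p.re < b)
    (hC : ∀ s : ℂ, a ≤ s.re → s.re ≤ b → ‖H s‖ ≤ C / (1 + s.im ^ 2)) :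
    (∫ u : ℝ, H (b + u * I) / (b + u * I - p)) - (∫ u : ℝ, H (a + u * I) / (a + u * I - p))
      = 2 * Real.pi * H p := by
  set β : ℝ := b - p.re with hβdef
  have hβ : 0 < β := by linarith
  have hab : a ≤ b := by linarith
  set k : ℂ → ℂ := fun s => 2 * β / (2 * β - (s - p)) with hk
  set F : ℂ → ℂ := fun s => H s - H p * k s with hF
  have hden : ∀ s : ℂ, s.re < p.re + 2 * β → (2 * β - (s - p) : ℂ) ≠ 0 := by
    intro s hs h
    have := congrArg re h; simp at this; linarith
  have hkp : k p = 1 := by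
    have : (β : ℂ) ≠ 0 := by exact_mod_cast hβ.ne'
    simp [hk, this]
  have hFp : F p = 0 := by simp [hF, hkp]
  have hUo : IsOpen {s : ℂ | s.re < p.re + 2 * β} := isOpen_lt continuous_re continuous_const
  have hFd : DifferentiableOn ℂ F {s : ℂ | s.re < p.re + 2 * β} := by
    intro s hs
    refine DifferentiableAt.differentiableWithinAt ?_
    have := hden s hs
    have h2 := hH s
    simp only [hF, hk]
    fun_prop (disch := assumption)
  have hgd' : DifferentiableOn ℂ (dslope F p) {s : ℂ | s.re < p.re + 2 * β} :=
    (Complex.differentiableOn_dslope (hUo.mem_nhds (by simp [hβ]))).2 hFd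
  have hgd : ∀ s : ℂ, a ≤ s.re → s.re ≤ b → DifferentiableAt ℂ (dslope F p) s := fun s _ h2 =>
    hgd'.differentiableAt (hUo.mem_nhds (by simp only [mem_ofPred_eq]; linarith))
  have hg : ∀ s : ℂ, s ≠ p → dslope F p s = H s / (s - p) - H p * poleKernel β (s - p) := by
    intro s hs
    have h1 : s - p ≠ 0 := sub_ne_zero.2 hs
    rw [dslope_of_ne _ hs, slope_def_field, hFp, sub_zero, hF, hk, poleKernel]
    simp only [sub_div, mul_div_assoc, div_div]
  obtain ⟨C', hC'⟩ := exists_bound_strip (U := 2 * |p.im| + 1)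
    (C := C + ‖H p‖ * (16 * β)) hgd (fun s h1 h2 h3 => by
      have hy : |s.im| / 2 + 1 / 2 ≤ |(s - p).im| := by
        have := abs_sub_abs_le_abs_sub s.im p.im
        rw [sub_im]; linarith
      have hsp : s ≠ p := by
        rintro rfl
        simp at hy; linarith [abs_nonneg s.im]
      have hy2 : (1 + s.im ^ 2) / 4 ≤ (s - p).im ^ 2 := by
        rw [← sq_abs (s - p).im, ← sq_abs s.im]
        nlinarith [abs_nonneg s.im, abs_nonneg (s - p).im]
      have hn1 : |(s - p).im| ≤ ‖s - p‖ := abs_im_le_norm _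
      have hn2 : |(s - p).im| ≤ ‖2 * β - (s - p)‖ := by
        simpa [abs_sub_comm] using abs_im_le_norm (2 * β - (s - p))
      have hn3 : 1 ≤ ‖s - p‖ := by
        have : 1 ≤ |(s - p).im| := by
          have := abs_sub_abs_le_abs_sub s.im p.im
          rw [sub_im]; linarith [abs_nonneg p.im]
        linarith
      rw [hg s hsp, add_div]
      refine (norm_sub_le _ _).trans (add_le_add ?_ ?_)
      · rw [norm_div]
        exact (div_le_self (norm_nonneg _) hn3).trans (hC s h1 h2)
      · rw [norm_mul, mul_div_assoc]
        gcongr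
        have h3 : ‖(2 * β : ℂ)‖ = 2 * β := by simp [abs_of_pos hβ]
        rw [poleKernel, norm_div, h3, norm_mul]
        have hd : (1 + s.im ^ 2) / 4 ≤ ‖2 * β - (s - p)‖ * ‖s - p‖ := by
          refine hy2.trans ?_
          rw [← sq_abs, sq]
          gcongr
        calc 2 * β / (‖2 * β - (s - p)‖ * ‖s - p‖) ≤ 2 * β / ((1 + s.im ^ 2) / 4) := by gcongr
          _ ≤ 16 * β / (1 + s.im ^ 2) := by
            rw [div_div_eq_mul_div]
            refine div_le_div_of_nonneg_right ?_ (by positivity)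
            linarith)
  have hmain := integral_vertical_eq hab hgd hC'
  have hHd : ∀ σ : ℝ, a ≤ σ → σ ≤ b → σ ≠ p.re →
      Integrable (fun u : ℝ => dslope F p (σ + u * I)) ∧
      Integrable (fun u : ℝ => H (σ + u * I) / (σ + u * I - p)) := by
    intro σ h1 h2 h3
    refine ⟨integrable_vertical h1 h2 hgd hC', ?_⟩
    have hne : ∀ u : ℝ, (σ + u * I - p : ℂ) ≠ 0 := by
      intro u h; have := congrArg re h; simp at this; exact h3 (by linarith)
    refine Integrable.mono' (integrable_const_div_one_add_sq (C / |σ - p.re|)) ?_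
      (ae_of_all _ fun u => ?_)
    · refine Continuous.aestronglyMeasurable ?_
      have := hH.continuous
      exact Continuous.div (by fun_prop) (by fun_prop) hne
    · rw [norm_div]
      have hb1 := hC (σ + u * I) (by simpa) (by simpa)
      have hb2 : |σ - p.re| ≤ ‖(σ + u * I - p : ℂ)‖ := by
        simpa using abs_re_le_norm (σ + u * I - p : ℂ)
      have hpos : 0 < |σ - p.re| := abs_pos.2 (sub_ne_zero.2 h3)
      simp at hb1
      calc _ ≤ C / (1 + u ^ 2) / |σ - p.re| := by
            gcongr
            exact (norm_nonneg _).trans hb1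
        _ = _ := by rw [div_right_comm]
  have hsplit : ∀ σ : ℝ, a ≤ σ → σ ≤ b → σ ≠ p.re →
      ∫ u : ℝ, dslope F p (σ + u * I) = (∫ u : ℝ, H (σ + u * I) / (σ + u * I - p))
        - H p * ∫ y : ℝ, poleKernel β ((σ - p.re : ℝ) + y * I) := by
    intro σ h1 h2 h3
    obtain ⟨i1, i2⟩ := hHd σ h1 h2 h3
    have e1 : ∫ y : ℝ, poleKernel β ((σ - p.re : ℝ) + y * I)
        = ∫ u : ℝ, poleKernel β (σ + u * I - p) := by
      rw [← integral_sub_right_eq_self _ p.im]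
      congr 1 with u
      congr 1
      apply Complex.ext <;> simp
    have e2 : ∀ u : ℝ, H (σ + u * I) / (σ + u * I - p) - dslope F p (σ + u * I)
        = H p * poleKernel β (σ + u * I - p) := by
      intro u
      rw [hg]
      · ring
      · intro h; have := congrArg re h; simp at this; exact h3 this
    rw [e1, ← integral_const_mul, ← integral_congr_ae (ae_of_all _ e2), integral_sub i2 i1]
    ring
  rw [hsplit a le_rfl hab (by linarith), hsplit b hab le_rfl (by linarith),
    integral_poleKernel_left hβ (by linarith), integral_poleKernel_right hβ] at hmain
  linear_combination -hmain

/-- Phragmén–Lindelöf: quadratic decay on the edges of a strip propagates to its interior. -/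
lemma exists_bound_of_edges {H : ℂ → ℂ} (hH : Differentiable ℂ H) {a b C M K : ℝ} (hab : a < b)
    (hK : 0 < K)
    (hexp : ∀ s : ℂ, a ≤ s.re → s.re ≤ b → 1 ≤ |s.im| → ‖H s‖ ≤ M * Real.exp (K * |s.im|))
    (hea : ∀ s : ℂ, s.re = a → ‖H s‖ ≤ C / (1 + s.im ^ 2))
    (heb : ∀ s : ℂ, s.re = b → ‖H s‖ ≤ C / (1 + s.im ^ 2)) :
    ∃ C' : ℝ, ∀ s : ℂ, a ≤ s.re → s.re ≤ b → ‖H s‖ ≤ C' / (1 + s.im ^ 2) := by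
  set G : ℂ → ℂ := fun s => H s * (s - a + 1) ^ 2 with hG
  have hn : ∀ s : ℂ, ‖s - a + 1‖ ^ 2 = (s.re - a + 1) ^ 2 + s.im ^ 2 := by
    intro s; rw [Complex.sq_norm, normSq_apply]; simp; ring
  have hC0 : 0 ≤ C := by
    have := (norm_nonneg _).trans (hea (a : ℂ) (by simp))
    simpa using this
  have hup : ∀ s : ℂ, a ≤ s.re → s.re ≤ b →
      ‖s - a + 1‖ ^ 2 ≤ (b - a + 1) ^ 2 * (1 + s.im ^ 2) := by
    intro s h1 h2
    rw [hn]
    have : (s.re - a + 1) ^ 2 ≤ (b - a + 1) ^ 2 := by gcongr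
    have h3 : 1 ≤ (b - a + 1) ^ 2 := by nlinarith
    nlinarith [sq_nonneg s.im]
  have hedge : ∀ s : ℂ, a ≤ s.re → s.re ≤ b → ‖H s‖ ≤ C / (1 + s.im ^ 2) →
      ‖G s‖ ≤ C * (b - a + 1) ^ 2 := by
    intro s h1 h2 h3
    rw [hG, norm_mul, norm_pow]
    calc _ ≤ C / (1 + s.im ^ 2) * ((b - a + 1) ^ 2 * (1 + s.im ^ 2)) := by
          gcongr
          exact hup s h1 h2
      _ = _ := by
        have : 1 + s.im ^ 2 ≠ 0 := by positivity
        field_simp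
  refine ⟨C * (b - a + 1) ^ 2, fun s h1 h2 => ?_⟩
  have hPL := PhragmenLindelof.vertical_strip (f := G) (a := a) (b := b)
    (C := C * (b - a + 1) ^ 2) (Differentiable.diffContOnCl (by rw [hG]; fun_prop)) ?_
    (fun z hz => hedge z hz.ge (hz.le.trans hab.le) (hea z hz))
    (fun z hz => hedge z (hab.le.trans hz.ge) hz.le (heb z hz)) h1 h2
  · rw [le_div_iff₀ (by positivity)]
    refine le_trans ?_ hPL
    rw [hG, norm_mul, norm_pow, hn]
    gcongr
    nlinarith
  · set c := Real.pi / (2 * (b - a)) with hc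
    have hba : 0 < b - a := by linarith
    have hcpos : 0 < c := by have := Real.pi_pos; positivity
    refine ⟨c, ?_, (K + 2) / c, ?_⟩
    · rw [hc]
      have := Real.pi_pos
      gcongr
      linarith
    · refine Asymptotics.IsBigO.of_bound (|M| * (b - a + 1) ^ 2) ?_
      rw [eventually_inf_principal]
      have : ∀ᶠ s : ℂ in comap (_root_.abs ∘ im) atTop, 1 ≤ |s.im| :=
        tendsto_comap.eventually (eventually_ge_atTop 1)
      filter_upwards [this] with s hs hmem
      have h1 : a ≤ s.re := hmem.1.le
      have h2 : s.re ≤ b := hmem.2.le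
      rw [hG, norm_mul, norm_pow, Real.norm_eq_abs, Real.abs_exp]
      have hx : (K + 2) * |s.im| ≤ (K + 2) / c * Real.exp (c * |s.im|) := by
        have h5 : c * |s.im| ≤ Real.exp (c * |s.im|) := by
          linarith [Real.add_one_le_exp (c * |s.im|)]
        calc _ = (K + 2) / c * (c * |s.im|) := by field_simp
          _ ≤ _ := by gcongr
      have hpoly : 1 + s.im ^ 2 ≤ Real.exp (2 * |s.im|) := by
        have h6 := Real.add_one_le_exp |s.im|
        rw [two_mul, Real.exp_add, ← sq_abs]
        nlinarith [abs_nonneg s.im]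
      calc _ ≤ |M| * Real.exp (K * |s.im|) * ((b - a + 1) ^ 2 * Real.exp (2 * |s.im|)) := by
            gcongr
            · exact (hexp s h1 h2 hs).trans (by gcongr; exact le_abs_self M)
            · exact (hup s h1 h2).trans (by gcongr)
        _ = |M| * (b - a + 1) ^ 2 * Real.exp ((K + 2) * |s.im|) := by
            rw [add_mul, Real.exp_add]; ring
        _ ≤ _ := by gcongr

end Contour

section GammaBounds

lemma norm_Gamma_le_real {s : ℂ} (hs : 0 < s.re) : ‖Gamma s‖ ≤ Real.Gamma s.re := by
  rw [Gamma_eq_integral hs, Real.Gamma_eq_integral hs, GammaIntegral]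
  refine norm_integral_le_of_norm_le (Real.GammaIntegral_convergent hs) ?_
  refine (ae_restrict_mem measurableSet_Ioi).mono fun x hx => le_of_eq ?_
  rw [norm_mul, norm_cpow_eq_rpow_re_of_pos hx]
  rw [norm_real, Real.norm_eq_abs, abs_of_pos (Real.exp_pos _)]; simp

lemma exists_norm_Gamma_le {a b : ℝ} (ha : 0 < a) :
    ∃ M : ℝ, ∀ s : ℂ, a ≤ s.re → s.re ≤ b → ‖Gamma s‖ ≤ M := by
  have hcont : ContinuousOn Real.Gamma (Icc a b) := fun x hx =>
    (Real.differentiableAt_Gamma fun m h => by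
      have := ha.trans_le hx.1
      rw [h] at this
      linarith [m.cast_nonneg (α := ℝ)]).continuousAt.continuousWithinAt
  obtain ⟨M, hM⟩ := isCompact_Icc.exists_bound_of_continuousOn hcont
  exact ⟨M, fun s h1 h2 => (norm_Gamma_le_real (ha.trans_le h1)).trans
    ((le_abs_self _).trans (hM s.re ⟨h1, h2⟩))⟩

lemma norm_Gamma_half_le {s : ℂ} (hs : s.re = 1 / 2) :
    ‖Gamma s‖ ≤ Real.sqrt (2 * Real.pi) * Real.exp (-(Real.pi / 2 * |s.im|)) := by
  have hconj : 1 - s = (starRingEnd ℂ) s := by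
    apply Complex.ext <;> simp [hs]; norm_num
  have hsin : Complex.sin (Real.pi * s) = Real.cosh (Real.pi * s.im) := by
    have : (Real.pi * s : ℂ) = Real.pi / 2 - (-(Real.pi * s.im : ℝ) * I) := by
      apply Complex.ext <;> simp [hs]; ring
    rw [this, Complex.sin_pi_div_two_sub, neg_mul, Complex.cos_neg, Complex.cos_mul_I]
    push_cast; rfl
  have h := Complex.Gamma_mul_Gamma_one_sub s
  rw [hconj, Complex.Gamma_conj, Complex.mul_conj, hsin] at h
  have h1 : Complex.normSq (Gamma s) = Real.pi / Real.cosh (Real.pi * s.im) := by exact_mod_cast h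
  rw [← sq_le_sq₀ (norm_nonneg _) (by positivity), mul_pow, Real.sq_sqrt (by positivity),
    ← Complex.normSq_eq_norm_sq, h1, div_le_iff₀ (Real.cosh_pos _), ← Real.cosh_abs,
    Real.cosh_eq, abs_mul, abs_of_pos Real.pi_pos, ← Real.exp_nat_mul]
  have e1 : Real.exp ((2 : ℕ) * -(Real.pi / 2 * |s.im|)) * Real.exp (Real.pi * |s.im|) = 1 := by
    rw [← Real.exp_add, ← Real.exp_zero]; congr 1; push_cast; ring
  have e2 : 0 < Real.exp ((2 : ℕ) * -(Real.pi / 2 * |s.im|)) * Real.exp (-(Real.pi * |s.im|)) := by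
    positivity
  have : 0 < Real.pi := Real.pi_pos
  nlinarith

lemma norm_Gamma_nat_add_half_le (n : ℕ) {s : ℂ} (hs : s.re = n + 1 / 2) :
    ‖Gamma s‖ ≤ Real.sqrt (2 * Real.pi) * Real.exp (-(Real.pi / 2 * |s.im|)) * ‖s + 1‖ ^ n := by
  induction n generalizing s with
  | zero => simpa using norm_Gamma_half_le (s := s) (by simpa using hs)
  | succ n ih =>
    have h1 : (s - 1).re = n + 1 / 2 := by simp [hs]; ring
    have h2 : s - 1 ≠ 0 := by
      intro h; rw [h] at h1; simp at h1; nlinarith [n.cast_nonneg (α := ℝ)]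
    have h3 := Complex.Gamma_add_one (s - 1) h2
    rw [sub_add_cancel] at h3
    have h4 := ih h1
    have hle : ‖s - 1‖ ≤ ‖s + 1‖ ∧ ‖s - 1 + 1‖ ≤ ‖s + 1‖ := by
      constructor <;>
      · rw [← sq_le_sq₀ (norm_nonneg _) (norm_nonneg _), Complex.sq_norm, Complex.sq_norm,
          normSq_apply, normSq_apply]
        simp [hs]; nlinarith [n.cast_nonneg (α := ℝ)]
    rw [h3, norm_mul, pow_succ]
    simp only [sub_im, one_im, sub_zero] at h4
    calc _ ≤ ‖s + 1‖ * (Real.sqrt (2 * Real.pi) * Real.exp (-(Real.pi / 2 * |s.im|)) *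
          ‖s + 1‖ ^ n) := by
          gcongr
          · exact hle.1
          · exact h4.trans (by gcongr; exact hle.2)
      _ = _ := by ring

lemma norm_Gamma_mul_exp_le {n : ℕ} (hn : 0 < n) {ε : ℝ} (hε : |ε| = 1) {s : ℂ}
    (h1 : 1 / 2 ≤ s.re) (h2 : s.re ≤ n + 1 / 2) :
    ‖Gamma s‖ * Real.exp (Real.pi / 2 * (ε * s.im)) ≤ Real.sqrt (2 * Real.pi) * ‖s + 1‖ ^ n := by
  set f : ℂ → ℂ := fun s => Gamma s * cexp (-(ε * Real.pi / 2 * I * s)) / (s + 1) ^ n with hf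
  have hs1 : ∀ s : ℂ, 1 / 2 ≤ s.re → 1 ≤ ‖s + 1‖ := fun s hs => by
    have := abs_re_le_norm (s + 1)
    simp only [add_re, one_re] at this
    linarith [le_abs_self (s.re + 1)]
  have hnf : ∀ s : ℂ, ‖f s‖ = ‖Gamma s‖ * Real.exp (Real.pi / 2 * (ε * s.im)) / ‖s + 1‖ ^ n := by
    intro s
    rw [hf, norm_div, norm_mul, norm_pow, Complex.norm_exp]
    congr 3
    simp
    ring
  have hεim : ∀ s : ℂ, ε * s.im ≤ |s.im| := fun s => by
    have := le_abs_self (ε * s.im); rwa [abs_mul, hε, one_mul] at this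
  have hedge : ∀ k : ℕ, k ≤ n → ∀ z : ℂ, z.re = k + 1 / 2 → ‖f z‖ ≤ Real.sqrt (2 * Real.pi) := by
    intro k hk z hz
    have hz1 := hs1 z (by rw [hz]; linarith [k.cast_nonneg (α := ℝ)])
    rw [hnf, div_le_iff₀ (by positivity)]
    calc _ ≤ (Real.sqrt (2 * Real.pi) * Real.exp (-(Real.pi / 2 * |z.im|)) * ‖z + 1‖ ^ k) *
          Real.exp (Real.pi / 2 * |z.im|) := by
          have := Real.pi_pos
          gcongr
          · exact norm_Gamma_nat_add_half_le k hz
          · exact hεim z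
      _ = Real.sqrt (2 * Real.pi) * ‖z + 1‖ ^ k := by
        have : Real.exp (-(Real.pi / 2 * |z.im|)) * Real.exp (Real.pi / 2 * |z.im|) = 1 := by
          rw [← Real.exp_add]; simp
        linear_combination Real.sqrt (2 * Real.pi) * ‖z + 1‖ ^ k * this
      _ ≤ _ := by gcongr
  have hd : ∀ z : ℂ, 1 / 2 ≤ z.re → DifferentiableAt ℂ f z := by
    intro z hz
    have hΓ : DifferentiableAt ℂ Gamma z := Complex.differentiableAt_Gamma z (fun m h => by
      rw [h] at hz; simp at hz; linarith [m.cast_nonneg (α := ℝ)])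
    have h0 : (z + 1) ^ n ≠ 0 := pow_ne_zero _ (norm_pos_iff.1 (by linarith [hs1 z hz]))
    simp only [hf]
    fun_prop (disch := assumption)
  have hn' : (1 : ℝ) ≤ n := by exact_mod_cast hn
  have hPL := PhragmenLindelof.vertical_strip (f := f) (a := 1 / 2) (b := n + 1 / 2)
    (C := Real.sqrt (2 * Real.pi)) (z := s) ?_ ?_ (fun z hz => hedge 0 (by omega) z (by simpa using hz))
    (fun z hz => hedge n le_rfl z hz) h1 h2
  · rw [hnf, div_le_iff₀ (by have := hs1 s h1; positivity)] at hPL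
    exact hPL
  · refine DifferentiableOn.diffContOnCl fun z hz => (hd z ?_).differentiableWithinAt
    have := closure_mono (t := re ⁻¹' Ici (1 / 2 : ℝ))
      (preimage_mono (Ioo_subset_Ioi_self.trans Ioi_subset_Ici_self)) hz
    rwa [(isClosed_Ici.preimage continuous_re).closure_eq] at this
  · obtain ⟨M, hM⟩ := exists_norm_Gamma_le (a := 1 / 2) (b := n + 1 / 2) (by norm_num)
    set c := Real.pi / (2 * n) with hc
    have hcpos : 0 < c := by have := Real.pi_pos; positivity
    refine ⟨c, ?_, Real.pi / 2 / c, ?_⟩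
    · rw [hc, add_sub_cancel_right]
      have := Real.pi_pos
      gcongr
      linarith
    · refine Asymptotics.IsBigO.of_bound |M| ?_
      rw [eventually_inf_principal]
      refine Eventually.of_forall fun z hz => ?_
      have hz1 := hs1 z hz.1.le
      rw [hnf, Real.norm_eq_abs, Real.abs_exp]
      have h6 : Real.pi / 2 * |z.im| ≤ Real.pi / 2 / c * Real.exp (c * |z.im|) := by
        have h5 : c * |z.im| ≤ Real.exp (c * |z.im|) := by
          linarith [Real.add_one_le_exp (c * |z.im|)]
        have := Real.pi_pos
        calc _ = Real.pi / 2 / c * (c * |z.im|) := by field_simp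
          _ ≤ _ := by gcongr
      refine (div_le_self (by positivity) (one_le_pow₀ hz1)).trans ?_
      have := Real.pi_pos
      refine mul_le_mul ((hM z hz.1.le hz.2.le).trans (le_abs_self M)) (Real.exp_le_exp.2 ?_)
        (Real.exp_pos _).le (abs_nonneg M)
      exact (mul_le_mul_of_nonneg_left (hεim z) (by positivity)).trans h6

/-- Exponential decay of the Gamma function on vertical strips. -/
lemma exists_norm_Gamma_le_exp {a : ℝ} (ha : 0 < a) (b : ℝ) :
    ∃ C : ℝ, 0 ≤ C ∧ ∃ N : ℕ, ∀ s : ℂ, a ≤ s.re → s.re ≤ b →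
      ‖Gamma s‖ ≤ C * (1 + |s.im|) ^ N * Real.exp (-(Real.pi / 2 * |s.im|)) := by
  obtain ⟨n, hn⟩ := exists_nat_ge (b + 1)
  refine ⟨a⁻¹ * (Real.sqrt (2 * Real.pi) * (|b| + 2) ^ (n + 1)), by positivity, n + 1,
    fun s h1 h2 => ?_⟩
  have hs0 : s ≠ 0 := by rintro rfl; simp at h1; linarith
  have hΓ := Complex.Gamma_add_one s hs0
  have hb : ‖Gamma (s + 1)‖ * Real.exp (Real.pi / 2 * |s.im|) ≤
      Real.sqrt (2 * Real.pi) * ‖s + 1 + 1‖ ^ (n + 1) := by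
    have hr1 : 1 / 2 ≤ (s + 1).re := by simp; linarith
    have hr2 : (s + 1).re ≤ (n + 1 : ℕ) + 1 / 2 := by push_cast; simp; linarith
    rcases abs_cases s.im with ⟨h, _⟩ | ⟨h, _⟩
    · simpa [h] using norm_Gamma_mul_exp_le (n := n + 1) (by omega) (ε := 1) (by simp) hr1 hr2
    · simpa [h] using norm_Gamma_mul_exp_le (n := n + 1) (by omega) (ε := -1) (by simp) hr1 hr2
  have hs2 : ‖s + 1 + 1‖ ≤ (|b| + 2) * (1 + |s.im|) := by
    have h3 : ‖s + 1 + 1‖ ≤ |s.re + 2| + |s.im| := by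
      have := norm_le_abs_re_add_abs_im (s + 1 + 1)
      simpa [add_assoc, one_add_one_eq_two] using this
    rw [abs_of_pos (by linarith : 0 < s.re + 2)] at h3
    nlinarith [abs_nonneg s.im, abs_nonneg b, le_abs_self b, mul_nonneg (abs_nonneg b) (abs_nonneg s.im)]
  have hs3 : a ≤ ‖s‖ := h1.trans ((le_abs_self _).trans (abs_re_le_norm s))
  have hE : Real.exp (Real.pi / 2 * |s.im|) * Real.exp (-(Real.pi / 2 * |s.im|)) = 1 := by
    rw [← Real.exp_add]; simp
  have h5 : ‖Gamma s‖ ≤ a⁻¹ * ‖Gamma (s + 1)‖ := by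
    rw [hΓ, norm_mul, inv_mul_eq_div, le_div_iff₀ ha, mul_comm]
    gcongr
  calc ‖Gamma s‖ ≤ a⁻¹ * ‖Gamma (s + 1)‖ := h5
    _ = a⁻¹ * (‖Gamma (s + 1)‖ * Real.exp (Real.pi / 2 * |s.im|)) *
        Real.exp (-(Real.pi / 2 * |s.im|)) := by
        linear_combination -(a⁻¹ * ‖Gamma (s + 1)‖) * hE
    _ ≤ a⁻¹ * (Real.sqrt (2 * Real.pi) * ((|b| + 2) * (1 + |s.im|)) ^ (n + 1)) *
        Real.exp (-(Real.pi / 2 * |s.im|)) := by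
        have hb' := hb.trans (mul_le_mul_of_nonneg_left
          (pow_le_pow_left₀ (norm_nonneg _) hs2 (n + 1)) (Real.sqrt_nonneg _))
        gcongr
    _ = _ := by rw [mul_pow]; ring

end GammaBounds

section Mellin

lemma mellinT_eq_mellin (Φ : ℝ → ℂ) (s : ℂ) : mellinT Φ s = mellin Φ s := by
  simp [mellinT, mellin, mul_comm]

/-- A Mellin transform is bounded on closed strips of convergence. -/
lemma exists_norm_mellin_le {f : ℝ → ℂ} {a b : ℝ} (ha : MellinConvergent f a)
    (hb : MellinConvergent f b) : ∃ M : ℝ, ∀ s : ℂ, a ≤ s.re → s.re ≤ b → ‖mellin f s‖ ≤ M := by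
  refine ⟨∫ t in Ioi (0 : ℝ), (‖(t : ℂ) ^ ((a : ℂ) - 1) • f t‖ + ‖(t : ℂ) ^ ((b : ℂ) - 1) • f t‖),
    fun s h1 h2 => ?_⟩
  refine norm_integral_le_of_norm_le (ha.norm.add hb.norm) ?_
  refine (ae_restrict_mem measurableSet_Ioi).mono fun t ht => ?_
  rw [norm_smul, norm_smul, norm_smul, norm_cpow_eq_rpow_re_of_pos ht,
    norm_cpow_eq_rpow_re_of_pos ht, norm_cpow_eq_rpow_re_of_pos ht, ← add_mul]
  have ht0 : 0 < t := ht
  simp only [sub_re, ofReal_re, one_re]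
  gcongr
  rcases le_total 1 t with h | h
  · have := Real.rpow_le_rpow_of_exponent_le h (by linarith : s.re - 1 ≤ b - 1)
    have := Real.rpow_nonneg ht0.le (a - 1)
    linarith
  · have := Real.rpow_le_rpow_of_exponent_ge ht0 h (by linarith : a - 1 ≤ s.re - 1)
    have := Real.rpow_nonneg ht0.le (b - 1)
    linarith

/-- Smooth functions with compact support in the open half-line. -/
structure IsTest (Φ : ℝ → ℂ) : Prop where
  contDiff : ContDiff ℝ (⊤ : ℕ∞) Φ
  compact : HasCompactSupport Φ
  supp : tsupport Φ ⊆ Ioi (0 : ℝ)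

namespace IsTest

variable {Φ : ℝ → ℂ}

lemma exists_bounds (h : IsTest Φ) :
    ∃ α β : ℝ, 0 < α ∧ α < β ∧ ∀ x, Φ x ≠ 0 → α ≤ x ∧ x ≤ β := by
  rcases (tsupport Φ).eq_empty_or_nonempty with h0 | h0
  · refine ⟨1, 2, one_pos, one_lt_two, fun x hx => ?_⟩
    have := subset_tsupport Φ hx
    simp [h0] at this
  · have hc : IsCompact (tsupport Φ) := h.compact
    obtain ⟨α, hα, hα'⟩ := hc.exists_isLeast h0
    obtain ⟨β, hβ, hβ'⟩ := hc.exists_isGreatest h0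
    have h1 : α ≤ β := hα' hβ
    exact ⟨α, β + 1, h.supp hα, by linarith, fun x hx =>
      ⟨hα' (subset_tsupport Φ hx), by linarith [hβ' (subset_tsupport Φ hx)]⟩⟩

lemma eventually_atTop (h : IsTest Φ) : ∀ᶠ x in atTop, Φ x = 0 := by
  obtain ⟨α, β, -, -, hb⟩ := h.exists_bounds
  filter_upwards [eventually_gt_atTop β] with x hx
  by_contra h0
  linarith [(hb x h0).2]

lemma eventually_zero (h : IsTest Φ) : ∀ᶠ x in 𝓝 0, Φ x = 0 := by
  obtain ⟨α, β, hα, -, hb⟩ := h.exists_bounds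
  filter_upwards [eventually_lt_nhds hα] with x hx
  by_contra h0
  linarith [(hb x h0).1]

lemma isBigO_top (h : IsTest Φ) (a : ℝ) : Φ =O[atTop] (fun x : ℝ => x ^ (-a)) :=
  (Asymptotics.isBigO_zero _ _).congr' (h.eventually_atTop.mono fun _ hx => hx.symm) EventuallyEq.rfl

lemma isBigO_zero (h : IsTest Φ) (a : ℝ) : Φ =O[𝓝[>] 0] (fun x : ℝ => x ^ (-a)) :=
  (Asymptotics.isBigO_zero _ _).congr'
    ((h.eventually_zero.filter_mono nhdsWithin_le_nhds).mono fun _ hx => hx.symm) EventuallyEq.rfl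

lemma locallyIntegrableOn (h : IsTest Φ) : LocallyIntegrableOn Φ (Ioi 0) :=
  h.contDiff.continuous.locallyIntegrable.locallyIntegrableOn _

lemma mellinConvergent (h : IsTest Φ) (s : ℂ) : MellinConvergent Φ s :=
  mellinConvergent_of_isBigO_rpow h.locallyIntegrableOn (h.isBigO_top (s.re + 1)) (by linarith)
    (h.isBigO_zero (s.re - 1)) (by linarith)

lemma differentiable_mellin (h : IsTest Φ) : Differentiable ℂ (mellin Φ) := fun s =>
  mellin_differentiableAt_of_isBigO_rpow h.locallyIntegrableOn (h.isBigO_top (s.re + 1))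
    (by linarith) (h.isBigO_zero (s.re - 1)) (by linarith)

lemma neg_mul_deriv (h : IsTest Φ) : IsTest (fun x => -(x : ℂ) * deriv Φ x) := by
  have hd : ContDiff ℝ (⊤ : ℕ∞) (deriv Φ) := (contDiff_infty_iff_deriv.1 h.contDiff).2
  have hs : tsupport (fun x : ℝ => -(x : ℂ) * deriv Φ x) ⊆ tsupport Φ :=
    tsupport_mul_subset_right.trans tsupport_deriv_subset
  exact ⟨(ofRealCLM.contDiff.neg).mul hd, h.compact.of_isClosed_subset (isClosed_tsupport _) hs,
    hs.trans h.supp⟩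

lemma mellin_neg_mul_deriv (h : IsTest Φ) (s : ℂ) :
    mellin (fun x => -(x : ℂ) * deriv Φ x) s = s * mellin Φ s := by
  have i1 := (h.mellinConvergent s).const_mul s
  have i2 := h.neg_mul_deriv.mellinConvergent s
  have key := integral_Ioi_of_hasDerivAt_of_tendsto (a := 0) (m := 0)
    (f := fun x : ℝ => (x : ℂ) ^ s * Φ x)
    (f' := fun x : ℝ => s * ((x : ℂ) ^ (s - 1) • Φ x) -
      (x : ℂ) ^ (s - 1) • (-(x : ℂ) * deriv Φ x)) ?_ ?_ (i1.sub i2) ?_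
  · rw [integral_sub i1 i2, integral_const_mul] at key
    have h0 : Φ 0 = 0 := h.eventually_zero.self_of_nhds
    rw [h0, mul_zero, sub_zero, sub_eq_zero] at key
    exact key.symm
  · refine ContinuousAt.continuousWithinAt ?_
    refine (continuousAt_const (y := (0 : ℂ))).congr ?_
    filter_upwards [h.eventually_zero] with x hx
    simp [hx]
  · intro x hx
    have hx0 : (x : ℂ) ≠ 0 := by exact_mod_cast (ne_of_gt hx)
    have d1 := ((hasDerivAt_id (x : ℂ)).cpow_const (c := s)
      (Or.inl (by simpa using hx))).comp_ofReal
    have d2 := (h.contDiff.differentiable (by simp) x).hasDerivAt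
    refine (d1.mul d2).congr_deriv ?_
    simp only [id, smul_eq_mul, cpow_sub _ _ hx0, cpow_one]
    field_simp
    ring
  · refine tendsto_const_nhds.congr' ?_
    filter_upwards [h.eventually_atTop] with x hx
    simp [hx]

lemma exists_norm_pow_mul_mellin_le (h : IsTest Φ) (a b : ℝ) (k : ℕ) :
    ∃ M : ℝ, ∀ s : ℂ, a ≤ s.re → s.re ≤ b → ‖s‖ ^ k * ‖mellin Φ s‖ ≤ M := by
  induction k generalizing Φ with
  | zero => simpa using exists_norm_mellin_le (h.mellinConvergent a) (h.mellinConvergent b)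
  | succ k ih =>
    obtain ⟨M, hM⟩ := ih h.neg_mul_deriv
    refine ⟨M, fun s h1 h2 => ?_⟩
    have := hM s h1 h2
    rw [h.mellin_neg_mul_deriv, norm_mul] at this
    rwa [pow_succ, mul_assoc]

/-- Rapid decay of the Mellin transform of a test function. -/
lemma exists_norm_mellin_le_div (h : IsTest Φ) (a b : ℝ) (k : ℕ) :
    ∃ M : ℝ, 0 ≤ M ∧ ∀ s : ℂ, a ≤ s.re → s.re ≤ b → ‖mellin Φ s‖ ≤ M / (1 + |s.im|) ^ k := by
  obtain ⟨M0, h0⟩ := h.exists_norm_pow_mul_mellin_le a b 0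
  obtain ⟨M1, h1⟩ := h.exists_norm_pow_mul_mellin_le a b k
  refine ⟨2 ^ k * (|M0| + |M1|), by positivity, fun s ha hb => ?_⟩
  have e0 := (h0 s ha hb).trans (le_abs_self _)
  have e1 := (h1 s ha hb).trans (le_abs_self _)
  rw [pow_zero, one_mul] at e0
  have him : |s.im| ≤ ‖s‖ := abs_im_le_norm s
  rw [le_div_iff₀ (by positivity)]
  have hpow : (1 + |s.im|) ^ k ≤ 2 ^ k * (1 + ‖s‖ ^ k) := by
    rcases le_total ‖s‖ 1 with hs | hs
    · calc _ ≤ (2 : ℝ) ^ k := by gcongr; linarith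
        _ ≤ _ := le_mul_of_one_le_right (by positivity) (by simp)
    · calc _ ≤ (2 * ‖s‖) ^ k := by gcongr; linarith
        _ = 2 ^ k * ‖s‖ ^ k := mul_pow _ _ _
        _ ≤ _ := by gcongr; linarith
  calc _ ≤ ‖mellin Φ s‖ * (2 ^ k * (1 + ‖s‖ ^ k)) := by gcongr
    _ = 2 ^ k * (‖mellin Φ s‖ + ‖s‖ ^ k * ‖mellin Φ s‖) := by ring
    _ ≤ _ := by gcongr

end IsTest

end Mellin

section LBounds

open HurwitzZeta

lemma norm_sin_pi_mul_le (z : ℂ) : ‖Complex.sin (Real.pi * z)‖ ≤ Real.exp (Real.pi * |z.im|) := by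
  rw [Complex.sin, norm_div, norm_mul, norm_I, mul_one, Complex.norm_ofNat, div_le_iff₀ two_pos,
    mul_two]
  refine (norm_sub_le _ _).trans (add_le_add ?_ ?_) <;>
  · rw [Complex.norm_exp]
    have := Real.pi_pos
    gcongr
    simp only [neg_re, mul_re, I_re, mul_zero, I_im, mul_one, zero_sub, neg_mul, neg_neg, mul_im,
      ofReal_re, ofReal_im, zero_mul, add_zero]
    nlinarith [le_abs_self z.im, neg_le_abs z.im]

lemma norm_cos_pi_mul_le (z : ℂ) : ‖Complex.cos (Real.pi * z)‖ ≤ Real.exp (Real.pi * |z.im|) := by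
  rw [Complex.cos, norm_div, Complex.norm_ofNat, div_le_iff₀ two_pos, mul_two]
  refine (norm_add_le _ _).trans (add_le_add ?_ ?_) <;>
  · rw [Complex.norm_exp]
    have := Real.pi_pos
    gcongr
    simp only [neg_re, mul_re, I_re, mul_zero, I_im, mul_one, zero_sub, neg_mul, neg_neg, mul_im,
      ofReal_re, ofReal_im, zero_mul, add_zero]
    nlinarith [le_abs_self z.im, neg_le_abs z.im]

lemma exists_norm_inv_Gamma_le : ∃ M : ℝ, 0 ≤ M ∧ ∀ z : ℂ, z.re ≤ 3 / 2 → -1 ≤ z.re →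
    1 / 2 ≤ |z.im| → ‖(Gamma z)⁻¹‖ ≤ M * Real.exp (Real.pi * |z.im|) := by
  obtain ⟨M, hM⟩ := exists_norm_Gamma_le (a := 1 / 2) (b := 3) (by norm_num)
  refine ⟨2 * |M|, by positivity, fun z h1 h2 h3 => ?_⟩
  have hz : z.im ≠ 0 := by intro h; rw [h] at h3; simp at h3; linarith
  have hz1 : 1 - z ≠ 0 := by
    intro h; have := congrArg im h; simp at this; exact hz this
  have hΓ := Complex.Gamma_mul_Gamma_one_sub z
  have hG0 : Gamma z ≠ 0 := Complex.Gamma_ne_zero fun m h => by rw [h] at hz; simp at hz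
  have hs0 : Complex.sin (Real.pi * z) ≠ 0 := by
    intro h
    rw [h, div_zero, mul_eq_zero] at hΓ
    rcases hΓ with h' | h'
    · exact hG0 h'
    · exact Complex.Gamma_ne_zero (s := 1 - z) (fun m h => by
        have := congrArg im h; simp at this; exact hz this) h'
  have hG2 := Complex.Gamma_add_one (1 - z) hz1
  have hpi : (Real.pi : ℂ) ≠ 0 := by exact_mod_cast Real.pi_ne_zero
  have heq : (Gamma z)⁻¹ = (Gamma (1 - z + 1) / (1 - z)) * (Complex.sin (Real.pi * z) / Real.pi) := by
    rw [hG2, mul_div_cancel_left₀ _ hz1]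
    rw [eq_div_iff hs0, mul_comm (Real.pi : ℂ)] at hΓ
    field_simp
    linear_combination -hΓ
  rw [heq, norm_mul, norm_div, norm_div]
  have e1 : ‖Gamma (1 - z + 1)‖ ≤ |M| := (hM _ (by simp; linarith) (by simp; linarith)).trans
    (le_abs_self M)
  have e2 : 1 / 2 ≤ ‖1 - z‖ := h3.trans (by simpa using abs_im_le_norm (1 - z))
  have e3 : 1 ≤ ‖(Real.pi : ℂ)‖ := by
    rw [norm_real, Real.norm_eq_abs, abs_of_pos Real.pi_pos]; linarith [Real.pi_gt_three]
  calc _ ≤ |M| / (1 / 2) * (Real.exp (Real.pi * |z.im|) / 1) := by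
        gcongr; exact norm_sin_pi_mul_le z
    _ = _ := by ring

lemma exists_norm_inv_Gammaℝ_le : ∃ M : ℝ, 0 ≤ M ∧ ∀ s : ℂ, -2 ≤ s.re → s.re ≤ 3 →
    1 ≤ |s.im| → ‖(Gammaℝ s)⁻¹‖ ≤ M * Real.exp (Real.pi * |s.im|) := by
  obtain ⟨M, hM0, hM⟩ := exists_norm_inv_Gamma_le
  refine ⟨Real.pi ^ (3 / 2 : ℝ) * M, by have := Real.pi_pos; positivity, fun s h1 h2 h3 => ?_⟩
  have him : (s / 2).im = s.im / 2 := by simp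
  have hre : (s / 2).re = s.re / 2 := by simp
  have h := hM (s / 2) (by rw [hre]; linarith) (by rw [hre]; linarith)
    (by rw [him, abs_div, abs_two]; linarith)
  rw [Gammaℝ_def, mul_inv, norm_mul, norm_inv, norm_cpow_eq_rpow_re_of_pos Real.pi_pos,
    ← Real.rpow_neg Real.pi_pos.le, mul_assoc]
  have := Real.pi_pos
  gcongr
  · linarith [Real.pi_gt_three]
  · simp; linarith
  · refine h.trans ?_
    refine mul_le_mul_of_nonneg_left (Real.exp_le_exp.2
      (mul_le_mul_of_nonneg_left ?_ Real.pi_pos.le)) hM0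
    rw [him, abs_div, abs_two]
    linarith [abs_nonneg s.im]

lemma exists_norm_completedHurwitzZetaEven_le (a : UnitAddCircle) : ∃ M : ℝ, 0 ≤ M ∧ ∀ s : ℂ,
    -1 ≤ s.re → s.re ≤ 2 → 1 ≤ |s.im| → ‖completedHurwitzZetaEven a s‖ ≤ M := by
  have hconv := fun s => ((hurwitzEvenFEPair a).isStrongFEPair_toStrongFEPair.hasMellin s).1
  obtain ⟨M, hM⟩ := exists_norm_mellin_le (a := -1) (b := 2) (hconv _) (hconv _)
  refine ⟨|M| + 2, by positivity, fun s h1 h2 h3 => ?_⟩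
  have hn : 1 ≤ ‖s‖ := h3.trans (abs_im_le_norm s)
  have hn' : 1 ≤ ‖1 - s‖ := h3.trans (by simpa using abs_im_le_norm (1 - s))
  have e1 : ‖completedHurwitzZetaEven₀ a s‖ ≤ |M| := by
    rw [completedHurwitzZetaEven₀, norm_div, Complex.norm_ofNat]
    have := (hM (s / 2) (by simp; linarith) (by simp; linarith)).trans (le_abs_self M)
    refine (div_le_self (norm_nonneg _) one_le_two).trans this
  have e2 : ‖((if a = 0 then 1 else 0 : ℂ)) / s‖ ≤ 1 := by
    rw [norm_div]
    refine (div_le_self (norm_nonneg _) hn).trans ?_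
    split_ifs <;> simp
  have e3 : ‖1 / (1 - s)‖ ≤ 1 := by
    rw [norm_div, norm_one]; exact div_le_self zero_le_one hn'
  rw [completedHurwitzZetaEven_eq]
  refine (norm_sub_le _ _).trans ?_
  have := norm_sub_le (completedHurwitzZetaEven₀ a s) ((if a = 0 then 1 else 0 : ℂ) / s)
  linarith

lemma exists_norm_completedHurwitzZetaOdd_le (a : UnitAddCircle) : ∃ M : ℝ, 0 ≤ M ∧ ∀ s : ℂ,
    -1 ≤ s.re → s.re ≤ 2 → ‖completedHurwitzZetaOdd a s‖ ≤ M := by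
  have hconv := fun s => ((isStrong_hurwitzOddFEPair a).hasMellin s).1
  obtain ⟨M, hM⟩ := exists_norm_mellin_le (a := 0) (b := 2) (hconv _) (hconv _)
  refine ⟨|M|, by positivity, fun s h1 h2 => ?_⟩
  rw [completedHurwitzZetaOdd, (isStrong_hurwitzOddFEPair a).Λ_eq, norm_div, Complex.norm_ofNat]
  have := (hM ((s + 1) / 2) (by simp; linarith) (by simp; linarith)).trans (le_abs_self M)
  exact (div_le_self (norm_nonneg _) one_le_two).trans this

lemma exists_norm_hurwitzZeta_le (a : UnitAddCircle) : ∃ M : ℝ, 0 ≤ M ∧ ∀ s : ℂ,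
    -1 ≤ s.re → s.re ≤ 2 → 1 ≤ |s.im| → ‖hurwitzZeta a s‖ ≤ M * Real.exp (Real.pi * |s.im|) := by
  obtain ⟨M1, h10, h1⟩ := exists_norm_completedHurwitzZetaEven_le a
  obtain ⟨M2, h20, h2⟩ := exists_norm_completedHurwitzZetaOdd_le a
  obtain ⟨M, hM0, hM⟩ := exists_norm_inv_Gammaℝ_le
  refine ⟨(M1 + M2) * M, by positivity, fun s hs1 hs2 hs3 => ?_⟩
  have hs : s ≠ 0 := by rintro rfl; simp at hs3; linarith
  rw [hurwitzZeta, hurwitzZetaEven_def_of_ne_or_ne (Or.inr hs), hurwitzZetaOdd, div_eq_mul_inv,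
    div_eq_mul_inv, add_mul, add_mul]
  refine (norm_add_le _ _).trans (add_le_add ?_ ?_)
  · rw [norm_mul, mul_assoc]
    exact mul_le_mul (h1 s hs1 hs2 hs3) (hM s (by linarith) (by linarith) hs3) (norm_nonneg _) h10
  · rw [norm_mul, mul_assoc]
    have := hM (s + 1) (by simp; linarith) (by simp; linarith) (by simpa)
    simp only [add_im, one_im, add_zero] at this
    exact mul_le_mul (h2 s hs1 hs2) this (norm_nonneg _) h20

variable {c : ℕ} [NeZero c]

lemma exists_norm_LFunction_le (Ψ : ZMod c → ℂ) : ∃ M : ℝ, 0 ≤ M ∧ ∀ s : ℂ,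
    -1 ≤ s.re → s.re ≤ 2 → 1 ≤ |s.im| →
      ‖ZMod.LFunction Ψ s‖ ≤ M * Real.exp (Real.pi * |s.im|) := by
  choose M hM0 hM using fun j : ZMod c => exists_norm_hurwitzZeta_le (ZMod.toAddCircle j)
  refine ⟨c * ∑ j, ‖Ψ j‖ * M j, mul_nonneg (by positivity) (Finset.sum_nonneg fun j _ =>
    mul_nonneg (norm_nonneg _) (hM0 j)), fun s h1 h2 h3 => ?_⟩
  have hc : (1 : ℝ) ≤ c := by exact_mod_cast Nat.one_le_iff_ne_zero.2 (NeZero.ne c)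
  rw [ZMod.LFunction, norm_mul, mul_assoc, Finset.sum_mul]
  have e1 : ‖(c : ℂ) ^ (-s)‖ ≤ c := by
    rw [norm_natCast_cpow_of_pos (Nat.pos_of_ne_zero (NeZero.ne c))]
    calc (c : ℝ) ^ (-s).re ≤ (c : ℝ) ^ (1 : ℝ) := by
          apply Real.rpow_le_rpow_of_exponent_le hc
          simp; linarith
      _ = c := Real.rpow_one _
  refine mul_le_mul e1 ((norm_sum_le _ _).trans (Finset.sum_le_sum fun j _ => ?_)) (norm_nonneg _)
    (by positivity)
  rw [norm_mul, mul_assoc]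
  gcongr
  exact hM j s h1 h2 h3

/-- The entire continuation of `(s - 1) L(Ψ, s)`. -/
noncomputable def Lstar (Ψ : ZMod c → ℂ) : ℂ → ℂ :=
  Function.update (fun s => (s - 1) * ZMod.LFunction Ψ s) 1 (∑ j, Ψ j / c)

lemma Lstar_of_ne (Ψ : ZMod c → ℂ) {s : ℂ} (hs : s ≠ 1) :
    Lstar Ψ s = (s - 1) * ZMod.LFunction Ψ s := Function.update_of_ne hs _ _

lemma Lstar_one (Ψ : ZMod c → ℂ) : Lstar Ψ 1 = ∑ j, Ψ j / c := Function.update_self _ _ _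

lemma differentiable_Lstar (Ψ : ZMod c → ℂ) : Differentiable ℂ (Lstar Ψ) := by
  have hne : ∀ s : ℂ, s ≠ 1 → DifferentiableAt ℂ (Lstar Ψ) s := by
    intro s hs
    have h1 : DifferentiableAt ℂ (fun s => (s - 1) * ZMod.LFunction Ψ s) s :=
      (by fun_prop : DifferentiableAt ℂ (fun s : ℂ => s - 1) s).mul
        (ZMod.differentiableAt_LFunction Ψ s (Or.inl hs))
    refine h1.congr_of_eventuallyEq ?_
    filter_upwards [isOpen_ne.mem_nhds hs] with z hz using Lstar_of_ne Ψ hz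
  intro s
  rcases eq_or_ne s 1 with rfl | hs
  · refine (Complex.analyticAt_of_differentiable_on_punctured_nhds_of_continuousAt ?_
      ?_).differentiableAt
    · exact eventually_mem_nhdsWithin.mono fun z hz => hne z hz
    · exact continuousAt_update_same.2 (ZMod.LFunction_residue_one Ψ)
  · exact hne s hs

lemma exists_norm_Lstar_le (Ψ : ZMod c → ℂ) : ∃ M : ℝ, 0 ≤ M ∧ ∀ s : ℂ,
    -1 ≤ s.re → s.re ≤ 2 → ‖Lstar Ψ s‖ ≤ M * Real.exp ((Real.pi + 1) * |s.im|) := by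
  obtain ⟨M, hM0, hM⟩ := exists_norm_LFunction_le Ψ
  have hK : IsCompact (Icc (-1 : ℝ) 2 ×ℂ Icc (-1 : ℝ) 1) := isCompact_Icc.reProdIm isCompact_Icc
  obtain ⟨M', hM'⟩ := hK.exists_bound_of_continuousOn (f := Lstar Ψ)
    (differentiable_Lstar Ψ).continuous.continuousOn
  refine ⟨2 * M + |M'|, by positivity, fun s h1 h2 => ?_⟩
  have hp := Real.pi_pos
  rcases le_total 1 |s.im| with h | h
  · have hs : s ≠ 1 := by rintro rfl; simp at h; linarith
    rw [Lstar_of_ne Ψ hs, norm_mul]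
    have e1 : ‖s - 1‖ ≤ 2 * Real.exp |s.im| := by
      have h3 := norm_le_abs_re_add_abs_im (s - 1)
      have h4 : |(s - 1).re| ≤ 2 := by rw [abs_le]; simp; constructor <;> linarith
      have h5 : |(s - 1).im| = |s.im| := by simp
      linarith [Real.add_one_le_exp |s.im|, abs_nonneg s.im]
    calc _ ≤ 2 * Real.exp |s.im| * (M * Real.exp (Real.pi * |s.im|)) :=
          mul_le_mul e1 (hM s h1 h2 h) (norm_nonneg _) (by positivity)
      _ = 2 * M * Real.exp ((Real.pi + 1) * |s.im|) := by
        rw [add_mul, Real.exp_add, one_mul]; ring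
      _ ≤ _ := by gcongr; linarith [abs_nonneg M']
  · have e1 := (hM' s ⟨⟨h1, h2⟩, abs_le.1 h⟩).trans (le_abs_self M')
    have e2 : 1 ≤ Real.exp ((Real.pi + 1) * |s.im|) := Real.one_le_exp (by positivity)
    nlinarith [abs_nonneg M']

end LBounds

section Estermann
open scoped LSeries.notation ZMod

variable {c : ℕ} [NeZero c]

/-- The additive character `a ↦ e(xa/c)` of `ZMod c`. -/
noncomputable def ec (x : ZMod c) : ZMod c → ℂ := fun a => ZMod.stdAddChar (x * a)

/-- The Estermann function, as a combination of products of `L`-functions of period `c`. -/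
noncomputable def est (u : ZMod c) (T : ℝ) (s : ℂ) : ℂ :=
  ∑ v : ZMod c, ZMod.LFunction (ec (v * u)) (s - 2 * T * I) *
    ZMod.LFunction (Pi.single v (1 : ℂ)) (s + 2 * T * I)

lemma LSeriesHasSum_mul_cpow {Ψ : ZMod c → ℂ} {s w : ℂ} (hs : 1 < (s - w).re) :
    LSeriesHasSum (fun n => Ψ n * (n : ℂ) ^ w) s (ZMod.LFunction Ψ (s - w)) := by
  have h1 := (ZMod.LSeriesSummable_of_one_lt_re Ψ hs).LSeriesHasSum
  rw [← ZMod.LFunction_eq_LSeries Ψ hs] at h1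
  refine Eq.subst (motive := fun f => HasSum f (ZMod.LFunction Ψ (s - w)))
    (funext fun n => ?_) h1
  rcases eq_or_ne n 0 with rfl | hn
  · simp
  · rw [LSeries.term_of_ne_zero hn, LSeries.term_of_ne_zero hn,
      cpow_sub _ _ (Nat.cast_ne_zero.2 hn)]
    have h2 : (n : ℂ) ^ w ≠ 0 := by simp [cpow_eq_zero_iff, hn]
    field_simp

lemma tauT_eq_sum_divisorsAntidiagonal (n : ℕ) (T : ℝ) :
    tauT n T = ∑ p ∈ n.divisorsAntidiagonal,
      (p.1 : ℂ) ^ (2 * T * I) * (p.2 : ℂ) ^ (-(2 * T * I)) := by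
  rw [Nat.sum_divisorsAntidiagonal (f := fun a b : ℕ =>
    (a : ℂ) ^ (2 * T * I) * (b : ℂ) ^ (-(2 * T * I)))]
  refine Finset.sum_congr rfl fun d hd => ?_
  have h1 := Complex.mul_cpow_ofReal_nonneg (a := (d : ℝ)) (b := ((n / d : ℕ) : ℝ)⁻¹)
    (by positivity) (by positivity) (2 * T * I)
  push_cast at h1
  rw [div_eq_mul_inv, h1, inv_cpow_eq_ite, cpow_neg]
  simp [Complex.natCast_arg, Real.pi_ne_zero.symm]

lemma LSeriesHasSum_est (u : ZMod c) (T : ℝ) {s : ℂ} (hs : 1 < s.re) :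
    LSeriesHasSum (fun n => tauT n T * ZMod.stdAddChar (u * (n : ZMod c))) s (est u T s) := by
  have h1 : ∀ v ∈ (Finset.univ : Finset (ZMod c)), LSeriesHasSum
      ((fun n => ec (v * u) n * (n : ℂ) ^ (2 * T * I)) ⍟
        (fun n => (Pi.single v (1 : ℂ) : ZMod c → ℂ) n * (n : ℂ) ^ (-(2 * T * I)))) s
      (ZMod.LFunction (ec (v * u)) (s - 2 * T * I) *
    ZMod.LFunction (Pi.single v (1 : ℂ)) (s + 2 * T * I)) := by
    intro v _
    refine LSeriesHasSum.convolution (LSeriesHasSum_mul_cpow (by simpa using hs)) ?_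
    have := LSeriesHasSum_mul_cpow (Ψ := Pi.single v (1 : ℂ)) (s := s) (w := -(2 * T * I))
      (by simpa using hs)
    rwa [sub_neg_eq_add] at this
  have h2 := hasSum_sum h1
  refine Eq.subst (motive := fun f => HasSum f (est u T s)) (funext fun n => ?_) h2
  rcases eq_or_ne n 0 with rfl | hn
  · simp
  simp only [LSeries.term_of_ne_zero hn, ← Finset.sum_div]
  congr 1
  simp only [LSeries.convolution_def]
  rw [Finset.sum_comm, tauT_eq_sum_divisorsAntidiagonal, Finset.sum_mul]
  refine Finset.sum_congr rfl fun p hp => ?_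
  rw [Finset.sum_eq_single (p.2 : ZMod c)]
  · have : (n : ZMod c) = p.1 * p.2 := by
      rw [← (Nat.mem_divisorsAntidiagonal.1 hp).1, Nat.cast_mul]
    rw [this, ec, Pi.single_eq_same,
      show (p.2 : ZMod c) * u * p.1 = u * (p.1 * p.2) by ring]
    ring
  · intro b _ hb
    rw [Pi.single_eq_of_ne hb.symm]; simp
  · simp

lemma dft_ec (x : ZMod c) : 𝓕 (ec x) = fun k => (c : ℂ) * (Pi.single x (1 : ℂ) : ZMod c → ℂ) k := by
  funext k
  rw [ZMod.dft_apply]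
  have h1 := AddChar.sum_mulShift (x - k) (ZMod.isPrimitive_stdAddChar c)
  rw [ZMod.card] at h1
  have h2 : ∀ j : ZMod c, ZMod.stdAddChar (-(j * k)) • ec x j =
      ZMod.stdAddChar (j * (x - k)) := by
    intro j
    rw [ec, smul_eq_mul, ← AddChar.map_add_eq_mul]
    congr 1; ring
  rw [Finset.sum_congr rfl fun j _ => h2 j, h1, Pi.single_apply]
  simp only [sub_eq_zero, eq_comm (a := k)]
  split_ifs <;> simp

lemma ec_neg (x : ZMod c) : (fun a => ec x (-a)) = ec (-x) := by
  funext a; simp [ec]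

lemma dft_single (v : ZMod c) : 𝓕 (Pi.single v (1 : ℂ) : ZMod c → ℂ) = ec (-v) := by
  funext k
  rw [ZMod.dft_apply, Finset.sum_eq_single v]
  · simp [ec]
  · intro b _ hb; simp [Pi.single_eq_of_ne hb]
  · simp

lemma single_neg_apply {N : ℕ} (v : ZMod N) :
    (fun a => (Pi.single v (1 : ℂ) : ZMod N → ℂ) (-a)) = Pi.single (-v) 1 := by
  funext a; simp [Pi.single_apply, neg_eq_iff_eq_neg]

lemma LFunction_const_mul (k : ℂ) (Ψ : ZMod c → ℂ) (s : ℂ) :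
    ZMod.LFunction (fun a => k * Ψ a) s = k * ZMod.LFunction Ψ s := by
  simp only [ZMod.LFunction, Finset.mul_sum]
  refine Finset.sum_congr rfl fun j _ => ?_
  ring

lemma LFunction_ec_one_sub (x : ZMod c) {w : ℂ} (hw : 1 < w.re) :
    ZMod.LFunction (ec x) (1 - w) = (c : ℂ) ^ w * (2 * Real.pi : ℂ) ^ (-w) * Gamma w *
      (cexp (Real.pi * I * w / 2) * ZMod.LFunction (Pi.single x (1 : ℂ)) w +
        cexp (-Real.pi * I * w / 2) * ZMod.LFunction (Pi.single (-x) (1 : ℂ)) w) := by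
  rw [ZMod.LFunction_one_sub (ec x) _ (Or.inr _), ec_neg, dft_ec, dft_ec, LFunction_const_mul,
    LFunction_const_mul, cpow_sub _ _ (Nat.cast_ne_zero.2 (NeZero.ne c)), cpow_one]
  · have : (c : ℂ) ≠ 0 := Nat.cast_ne_zero.2 (NeZero.ne c)
    field_simp
  · rintro n rfl; simp at hw; linarith [Nat.cast_nonneg (α := ℝ) n]
  · rintro rfl; simp at hw

lemma LFunction_single_one_sub (v : ZMod c) {w : ℂ} (hw : 1 < w.re) :
    ZMod.LFunction (Pi.single v (1 : ℂ)) (1 - w) =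
      (c : ℂ) ^ (w - 1) * (2 * Real.pi : ℂ) ^ (-w) * Gamma w *
      (cexp (Real.pi * I * w / 2) * ZMod.LFunction (ec (-v)) w +
        cexp (-Real.pi * I * w / 2) * ZMod.LFunction (ec v) w) := by
  rw [ZMod.LFunction_one_sub _ _ (Or.inr _), single_neg_apply, dft_single, dft_single, neg_neg]
  · rintro n rfl; simp at hw; linarith [Nat.cast_nonneg (α := ℝ) n]
  · rintro rfl; simp at hw

/-- The functional equation of the Estermann function. -/
lemma est_one_sub (u : (ZMod c)ˣ) (T : ℝ) {w : ℂ} (hw : 1 < w.re) :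
    est (u : ZMod c) T (1 - w) = (c : ℂ) ^ (2 * w - 1) *
      (G2p T w * est (↑u⁻¹ : ZMod c) T w + G2m T w * est (-(↑u⁻¹ : ZMod c)) T w) := by
  set w1 := w + 2 * T * I with hw1
  set w2 := w - 2 * T * I with hw2
  have r1 : 1 < w1.re := by simpa [hw1] using hw
  have r2 : 1 < w2.re := by simpa [hw2] using hw
  set A : ZMod c → ℂ := fun x => ZMod.LFunction (ec x) w2
  set D : ZMod c → ℂ := fun x => ZMod.LFunction (Pi.single x (1 : ℂ)) w1
  have k1 : ∑ v, D (v * u) * A v = est (↑u⁻¹ : ZMod c) T w := by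
    refine Eq.trans ?_ (Equiv.sum_comp (Units.mulRight u) fun x => A (x * ↑u⁻¹) * D x)
    simp [mul_comm]
  have k2 : ∑ v, D (v * u) * A (-v) = est (-(↑u⁻¹ : ZMod c)) T w := by
    refine Eq.trans ?_ (Equiv.sum_comp (Units.mulRight u) fun x => A (x * -(↑u⁻¹ : ZMod c)) * D x)
    simp [mul_comm]
  have k3 : ∑ v, D (-(v * u)) * A (-v) = est (↑u⁻¹ : ZMod c) T w := by
    rw [← k1, ← Equiv.sum_comp (Equiv.neg (ZMod c))]
    simp
  have k4 : ∑ v, D (-(v * u)) * A v = est (-(↑u⁻¹ : ZMod c)) T w := by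
    rw [← k2, ← Equiv.sum_comp (Equiv.neg (ZMod c))]
    simp
  have hc0 : (c : ℂ) ≠ 0 := Nat.cast_ne_zero.2 (NeZero.ne c)
  have hp0 : (2 * Real.pi : ℂ) ≠ 0 := by simp [Real.pi_ne_zero]
  set K := (c : ℂ) ^ (2 * w - 1) * ((2 * Real.pi : ℂ) ^ (-2 * w) * Gamma w2 * Gamma w1) with hK
  set E1 := cexp (Real.pi * I * w1 / 2) with hE1
  set F1 := cexp (-Real.pi * I * w1 / 2) with hF1
  set E2 := cexp (Real.pi * I * w2 / 2) with hE2
  set F2 := cexp (-Real.pi * I * w2 / 2) with hF2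
  have hterm : ∀ v : ZMod c, ZMod.LFunction (ec (v * (u : ZMod c))) (1 - w - 2 * T * I) *
      ZMod.LFunction (Pi.single v (1 : ℂ)) (1 - w + 2 * T * I) =
      K * (E1 * E2 * (D (v * u) * A (-v)) + E1 * F2 * (D (v * u) * A v) +
        F1 * E2 * (D (-(v * u)) * A (-v)) + F1 * F2 * (D (-(v * u)) * A v)) := by
    intro v
    rw [show 1 - w - 2 * T * I = 1 - w1 by rw [hw1]; ring,
      show 1 - w + 2 * T * I = 1 - w2 by rw [hw2]; ring,
      LFunction_ec_one_sub _ r1, LFunction_single_one_sub _ r2]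
    have hcc : (c : ℂ) ^ (2 * w - 1) = (c : ℂ) ^ w1 * (c : ℂ) ^ (w2 - 1) := by
      rw [← cpow_add _ _ hc0]; congr 1; rw [hw1, hw2]; ring
    have hpp : (2 * Real.pi : ℂ) ^ (-2 * w) = (2 * Real.pi : ℂ) ^ (-w1) * (2 * Real.pi : ℂ) ^ (-w2) := by
      rw [← cpow_add _ _ hp0]; congr 1; rw [hw1, hw2]; ring
    rw [hK, hcc, hpp]
    ring
  have q1 : E1 * F2 + F1 * E2 = 2 * Complex.cosh (2 * Real.pi * T) := by
    rw [hE1, hF2, hF1, hE2, ← Complex.exp_add, ← Complex.exp_add, Complex.cosh]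
    have i1 : Real.pi * I * w1 / 2 + -Real.pi * I * w2 / 2 = -(2 * Real.pi * T) := by
      rw [hw1, hw2]; linear_combination 2 * Real.pi * T * I_mul_I
    have i2 : -Real.pi * I * w1 / 2 + Real.pi * I * w2 / 2 = 2 * Real.pi * T := by
      rw [hw1, hw2]; linear_combination -2 * Real.pi * T * I_mul_I
    rw [i1, i2]; ring
  have q2 : E1 * E2 + F1 * F2 = 2 * Complex.cos (Real.pi * w) := by
    rw [hE1, hF2, hF1, hE2, ← Complex.exp_add, ← Complex.exp_add, Complex.cos]
    have i1 : Real.pi * I * w1 / 2 + Real.pi * I * w2 / 2 = Real.pi * w * I := by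
      rw [hw1, hw2]; ring
    have i2 : -Real.pi * I * w1 / 2 + -Real.pi * I * w2 / 2 = -(Real.pi * w) * I := by
      rw [hw1, hw2]; ring
    rw [i1, i2]; ring
  rw [show est (u : ZMod c) T (1 - w) = ∑ v : ZMod c, ZMod.LFunction (ec (v * (u : ZMod c)))
    (1 - w - 2 * T * I) * ZMod.LFunction (Pi.single v (1 : ℂ)) (1 - w + 2 * T * I) from rfl,
    Finset.sum_congr rfl fun v _ => hterm v,
    ← Finset.mul_sum, Finset.sum_add_distrib, Finset.sum_add_distrib, Finset.sum_add_distrib,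
    ← Finset.mul_sum, ← Finset.mul_sum, ← Finset.mul_sum, ← Finset.mul_sum, k1, k2, k3, k4,
    G2p, G2m, hK]
  push_cast
  linear_combination (c : ℂ) ^ (2 * w - 1) * ((2 * Real.pi : ℂ) ^ (-2 * w) * Gamma w2 * Gamma w1) *
    (est (↑u⁻¹ : ZMod c) T w * q1 + est (-(↑u⁻¹ : ZMod c)) T w * q2)

/-- The Estermann function shifted by one and multiplied by the factors cancelling its poles. -/
noncomputable def estStar (u : ZMod c) (T : ℝ) (s : ℂ) : ℂ :=
  ∑ v : ZMod c, Lstar (ec (v * u)) (1 + s - 2 * T * I) *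
    Lstar (Pi.single v (1 : ℂ)) (1 + s + 2 * T * I)

lemma differentiable_estStar (u : ZMod c) (T : ℝ) : Differentiable ℂ (estStar u T) := by
  unfold estStar
  refine Differentiable.fun_sum fun v _ => ?_
  exact ((differentiable_Lstar _).comp (by fun_prop)).mul
    ((differentiable_Lstar _).comp (by fun_prop))

lemma estStar_eq (u : ZMod c) (T : ℝ) {s : ℂ} (h1 : s ≠ 2 * T * I) (h2 : s ≠ -(2 * T * I)) :
    estStar u T s = (s - 2 * T * I) * (s + 2 * T * I) * est u T (1 + s) := by
  rw [estStar, est, Finset.mul_sum]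
  refine Finset.sum_congr rfl fun v _ => ?_
  rw [Lstar_of_ne, Lstar_of_ne]
  · ring
  · intro h; exact h2 (by linear_combination h)
  · intro h; exact h1 (by linear_combination h)

lemma exists_norm_estStar_le (u : ZMod c) (T : ℝ) : ∃ M : ℝ, ∀ s : ℂ,
    -2 ≤ s.re → s.re ≤ 1 → ‖estStar u T s‖ ≤ M * Real.exp (2 * (Real.pi + 1) * |s.im|) := by
  choose M hM0 hM using fun v : ZMod c => exists_norm_Lstar_le (ec (v * u))
  choose M' hM0' hM' using fun v : ZMod c => exists_norm_Lstar_le (Pi.single v (1 : ℂ) : ZMod c → ℂ)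
  refine ⟨∑ v, M v * M' v * Real.exp (2 * (Real.pi + 1) * |2 * T|), fun s h1 h2 => ?_⟩
  rw [Finset.sum_mul]
  refine (norm_sum_le _ _).trans (Finset.sum_le_sum fun v _ => ?_)
  have hp := Real.pi_pos
  have e1 : |(1 + s - 2 * T * I).im| ≤ |s.im| + |2 * T| := by
    simpa using abs_sub s.im (2 * T)
  have e2 : |(1 + s + 2 * T * I).im| ≤ |s.im| + |2 * T| := by
    simpa using abs_add_le s.im (2 * T)
  rw [norm_mul]
  calc _ ≤ (M v * Real.exp ((Real.pi + 1) * |(1 + s - 2 * T * I).im|)) *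
        (M' v * Real.exp ((Real.pi + 1) * |(1 + s + 2 * T * I).im|)) := by
        refine mul_le_mul (hM v _ ?_ ?_) (hM' v _ ?_ ?_) (norm_nonneg _)
          (mul_nonneg (hM0 v) (Real.exp_pos _).le) <;> simp <;> linarith
    _ ≤ (M v * Real.exp ((Real.pi + 1) * (|s.im| + |2 * T|))) *
        (M' v * Real.exp ((Real.pi + 1) * (|s.im| + |2 * T|))) := by
        have := hM0 v
        have := hM0' v
        gcongr
    _ = _ := by
        rw [show ∀ a b E : ℝ, a * E * (b * E) = a * b * (E * E) by intros; ring, ← Real.exp_add,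
          mul_assoc _ (Real.exp _), ← Real.exp_add]
        congr 2; ring

lemma LFunction_single_zero (s : ℂ) :
    ZMod.LFunction (Pi.single (0 : ZMod c) (1 : ℂ)) s = (c : ℂ) ^ (-s) * riemannZeta s := by
  rw [ZMod.LFunction, Finset.sum_eq_single 0]
  · simp [HurwitzZeta.hurwitzZeta_zero]
  · intro b _ hb; simp [Pi.single_eq_of_ne hb]
  · simp

lemma sum_ec (x : ZMod c) : ∑ j, ec x j = if x = 0 then (c : ℂ) else 0 := by
  have h1 := AddChar.sum_mulShift x (ZMod.isPrimitive_stdAddChar c)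
  rw [ZMod.card] at h1
  simp only [ec]
  simp_rw [mul_comm x, h1]
  split_ifs <;> simp

lemma sum_LFunction_ec (u : (ZMod c)ˣ) (s : ℂ) :
    ∑ v : ZMod c, ZMod.LFunction (ec (v * (u : ZMod c))) s = (c : ℂ) ^ (-s) * c * riemannZeta s := by
  simp only [ZMod.LFunction]
  rw [← Finset.mul_sum, Finset.sum_comm]
  have h1 : ∀ j : ZMod c, ∑ v : ZMod c, ec (v * (u : ZMod c)) j *
      HurwitzZeta.hurwitzZeta (ZMod.toAddCircle j) s =
      if j = 0 then (c : ℂ) * riemannZeta s else 0 := by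
    intro j
    rw [← Finset.sum_mul]
    have : ∀ v : ZMod c, ec (v * (u : ZMod c)) j = ec ((u : ZMod c) * j) v := by
      intro v; simp only [ec]; congr 1; ring
    rw [Finset.sum_congr rfl fun v _ => this v, sum_ec]
    split_ifs with h2 h3 h3
    · subst h3; simp [HurwitzZeta.hurwitzZeta_zero]
    · simp at h2; exact absurd h2 h3
    · subst h3; simp at h2
    · simp
  rw [Finset.sum_congr rfl fun j _ => h1 j, Finset.sum_ite_eq' , if_pos (Finset.mem_univ _)]
  ring

lemma estStar_two_mul_I (u : (ZMod c)ˣ) {T : ℝ} (hT : T ≠ 0) :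
    estStar (u : ZMod c) T (2 * T * I) =
      4 * T * I * ((c : ℂ) ^ (-1 - 4 * T * I) * riemannZeta (1 + 4 * T * I)) := by
  have hT' : (T : ℂ) ≠ 0 := ofReal_ne_zero.2 hT
  have hc0 : (c : ℂ) ≠ 0 := Nat.cast_ne_zero.2 (NeZero.ne c)
  rw [estStar, Finset.sum_eq_single 0]
  · rw [show 1 + 2 * T * I - 2 * T * I = 1 by ring, Lstar_one, zero_mul, ← Finset.sum_div, sum_ec,
      if_pos rfl, div_self hc0, one_mul, Lstar_of_ne, LFunction_single_zero]
    · rw [show 1 + 2 * T * I + 2 * T * I = 1 + 4 * T * I by ring, neg_add, ← sub_eq_add_neg]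
      ring
    · intro h
      have : 4 * T * I = 0 := by linear_combination h
      simp [hT'] at this
  · intro v _ hv
    rw [show 1 + 2 * T * I - 2 * T * I = 1 by ring, Lstar_one, ← Finset.sum_div, sum_ec, if_neg]
    · simp
    · simpa using hv
  · simp

lemma estStar_neg_two_mul_I (u : (ZMod c)ˣ) {T : ℝ} (hT : T ≠ 0) :
    estStar (u : ZMod c) T (-(2 * T * I)) =
      -(4 * T * I) * ((c : ℂ) ^ (-1 + 4 * T * I) * riemannZeta (1 - 4 * T * I)) := by
  have hT' : (T : ℂ) ≠ 0 := ofReal_ne_zero.2 hT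
  have hc0 : (c : ℂ) ≠ 0 := Nat.cast_ne_zero.2 (NeZero.ne c)
  have h1 : ∀ v : ZMod c, Lstar (ec (v * (u : ZMod c))) (1 + -(2 * T * I) - 2 * T * I) *
      Lstar (Pi.single v (1 : ℂ)) (1 + -(2 * T * I) + 2 * T * I) =
      -(4 * T * I) / c * ZMod.LFunction (ec (v * (u : ZMod c))) (1 - 4 * T * I) := by
    intro v
    rw [show 1 + -(2 * T * I) + 2 * T * I = 1 by ring,
      show 1 + -(2 * T * I) - 2 * T * I = 1 - 4 * T * I by ring, Lstar_one, Lstar_of_ne,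
      ← Finset.sum_div, Finset.sum_pi_single']
    · simp; ring
    · intro h
      have : 4 * T * I = 0 := by linear_combination -h
      simp [hT'] at this
  rw [estStar, Finset.sum_congr rfl fun v _ => h1 v, ← Finset.mul_sum, sum_LFunction_ec,
    neg_sub, sub_eq_add_neg, add_comm (4 * T * I)]
  field_simp

end Estermann

section Kernels

lemma one_add_abs_add_le (x t : ℝ) : 1 + |x + t| ≤ (1 + |t|) * (1 + |x|) := by
  nlinarith [abs_add_le x t, abs_nonneg x, abs_nonneg t]

lemma exists_norm_Gamma_mul_Gamma_le (T : ℝ) {a : ℝ} (ha : 0 < a) (b : ℝ) :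
    ∃ C : ℝ, 0 ≤ C ∧ ∃ N : ℕ, ∀ s : ℂ, a ≤ s.re → s.re ≤ b →
      ‖Gamma (s - 2 * T * I) * Gamma (s + 2 * T * I)‖ ≤
        C * (1 + |s.im|) ^ N * Real.exp (-(Real.pi * |s.im|)) := by
  obtain ⟨C, hC0, N, hC⟩ := exists_norm_Gamma_le_exp ha b
  refine ⟨(C * (1 + |2 * T|) ^ N) ^ 2, by positivity, 2 * N, fun s h1 h2 => ?_⟩
  have e1 := hC (s - 2 * T * I) (by simpa) (by simpa)
  have e2 := hC (s + 2 * T * I) (by simpa) (by simpa)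
  have i1 : (s - 2 * T * I).im = s.im - 2 * T := by simp
  have i2 : (s + 2 * T * I).im = s.im + 2 * T := by simp
  rw [i1] at e1
  rw [i2] at e2
  have a1 : 1 + |s.im - 2 * T| ≤ (1 + |2 * T|) * (1 + |s.im|) := by
    simpa [sub_eq_add_neg] using one_add_abs_add_le s.im (-(2 * T))
  have a2 := one_add_abs_add_le s.im (2 * T)
  rw [norm_mul]
  calc _ ≤ (C * (1 + |s.im - 2 * T|) ^ N * Real.exp (-(Real.pi / 2 * |s.im - 2 * T|))) *
        (C * (1 + |s.im + 2 * T|) ^ N * Real.exp (-(Real.pi / 2 * |s.im + 2 * T|))) :=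
        mul_le_mul e1 e2 (norm_nonneg _) (by positivity)
    _ ≤ (C * ((1 + |2 * T|) * (1 + |s.im|)) ^ N * Real.exp (-(Real.pi / 2 * |s.im - 2 * T|))) *
        (C * ((1 + |2 * T|) * (1 + |s.im|)) ^ N * Real.exp (-(Real.pi / 2 * |s.im + 2 * T|))) := by
        gcongr
    _ = (C * (1 + |2 * T|) ^ N) ^ 2 * (1 + |s.im|) ^ (2 * N) *
        Real.exp (-(Real.pi / 2 * (|s.im - 2 * T| + |s.im + 2 * T|))) := by
        rw [mul_add (Real.pi / 2), neg_add, Real.exp_add, mul_pow]; ring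
    _ ≤ _ := by
        have h3 := abs_add_le (s.im - 2 * T) (s.im + 2 * T)
        rw [show s.im - 2 * T + (s.im + 2 * T) = 2 * s.im by ring, abs_mul, abs_two] at h3
        exact mul_le_mul_of_nonneg_left (Real.exp_le_exp.2 (by nlinarith [Real.pi_pos]))
          (by positivity)

lemma norm_two_mul_two_pi_cpow_le {s : ℂ} (hb : 0 ≤ s.re) :
    ‖2 * ((2 * Real.pi : ℝ) : ℂ) ^ (-2 * s)‖ ≤ 2 := by
  have hp : (1 : ℝ) ≤ 2 * Real.pi := by linarith [Real.pi_gt_three]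
  rw [norm_mul, norm_cpow_eq_rpow_re_of_pos (by positivity)]
  have : (2 * Real.pi : ℝ) ^ (-2 * s).re ≤ 1 :=
    Real.rpow_le_one_of_one_le_of_nonpos hp (by simpa using hb)
  simp only [Complex.norm_ofNat]
  linarith

lemma exists_norm_G2_le (T : ℝ) {a : ℝ} (ha : 0 < a) (b : ℝ) :
    ∃ C : ℝ, 0 ≤ C ∧ ∃ N : ℕ, ∀ s : ℂ, a ≤ s.re → s.re ≤ b →
      ‖G2p T s‖ ≤ C * (1 + |s.im|) ^ N ∧ ‖G2m T s‖ ≤ C * (1 + |s.im|) ^ N := by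
  obtain ⟨C, hC0, N, hC⟩ := exists_norm_Gamma_mul_Gamma_le T ha b
  set D := ‖Complex.cosh (2 * Real.pi * T)‖ with hD
  have hD0 : 0 ≤ D := norm_nonneg _
  refine ⟨2 * C * (1 + D), by positivity, N, fun s h1 h2 => ?_⟩
  have e1 := hC s h1 h2
  have e2 := norm_two_mul_two_pi_cpow_le (ha.le.trans h1)
  have e3 := norm_cos_pi_mul_le s
  have hx : Real.exp (-(Real.pi * |s.im|)) ≤ 1 := Real.exp_le_one_iff.2 (by
    have := Real.pi_pos; simp; positivity)
  have hxx : Real.exp (-(Real.pi * |s.im|)) * Real.exp (Real.pi * |s.im|) = 1 := by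
    rw [← Real.exp_add]; simp
  set P := C * (1 + |s.im|) ^ N with hP
  have hP0 : 0 ≤ P := by positivity
  have hPD : 0 ≤ P * D := mul_nonneg hP0 hD0
  constructor
  · rw [G2p, mul_assoc (2 * _), norm_mul, norm_mul, ← hD]
    calc _ ≤ 2 * (P * 1) * D := by gcongr; exact e1.trans (by gcongr)
      _ ≤ _ := by nlinarith
  · rw [G2m, mul_assoc (2 * _), norm_mul, norm_mul]
    calc _ ≤ 2 * (P * Real.exp (-(Real.pi * |s.im|))) * Real.exp (Real.pi * |s.im|) := by gcongr
      _ = 2 * P * (Real.exp (-(Real.pi * |s.im|)) * Real.exp (Real.pi * |s.im|)) := by ring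
      _ ≤ _ := by rw [hxx]; nlinarith

lemma differentiableAt_Gamma_mul_Gamma {T : ℝ} {s : ℂ} (hs : 0 < s.re) :
    DifferentiableAt ℂ (fun s => 2 * ((2 * Real.pi : ℝ) : ℂ) ^ (-2 * s) * Gamma (s - 2 * T * I) *
      Gamma (s + 2 * T * I)) s := by
  have h0 : ∀ w : ℂ, 0 < w.re → DifferentiableAt ℂ Gamma w := fun w hw => by
    refine differentiableAt_Gamma w fun m => ?_
    rintro rfl
    simp at hw; linarith [Nat.cast_nonneg (α := ℝ) m]
  have h1 : DifferentiableAt ℂ (fun s => Gamma (s - 2 * T * I)) s :=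
    (h0 (s - 2 * T * I) (by simpa)).comp s (f := fun s => s - 2 * T * I) (by fun_prop)
  have h2 : DifferentiableAt ℂ (fun s => Gamma (s + 2 * T * I)) s :=
    (h0 (s + 2 * T * I) (by simpa)).comp s (f := fun s => s + 2 * T * I) (by fun_prop)
  have h3 : DifferentiableAt ℂ (fun s : ℂ => ((2 * Real.pi : ℝ) : ℂ) ^ (-2 * s)) s :=
    (by fun_prop : DifferentiableAt ℂ (fun s : ℂ => -2 * s) s).const_cpow
      (Or.inl (by simp [Real.pi_ne_zero]))
  exact ((h3.const_mul 2).mul h1).mul h2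

lemma differentiableAt_G2p {T : ℝ} {s : ℂ} (hs : 0 < s.re) : DifferentiableAt ℂ (G2p T) s :=
  (differentiableAt_Gamma_mul_Gamma hs).mul_const _

lemma differentiableAt_G2m {T : ℝ} {s : ℂ} (hs : 0 < s.re) : DifferentiableAt ℂ (G2m T) s :=
  (differentiableAt_Gamma_mul_Gamma hs).mul
    (Complex.differentiable_cos.differentiableAt.comp s (by fun_prop))

variable {Φ : ℝ → ℂ}

lemma one_div_one_add_abs_sq_le (y : ℝ) : 1 / (1 + |y|) ^ 2 ≤ 1 / (1 + y ^ 2) := by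
  apply one_div_le_one_div_of_le (by positivity)
  nlinarith [sq_abs y, abs_nonneg y]

lemma exists_norm_G2_mul_mellin_le (hΦ : IsTest Φ) (T : ℝ) {a : ℝ} (ha : 0 < a) (b : ℝ) :
    ∃ C : ℝ, 0 ≤ C ∧ ∀ s : ℂ, a ≤ s.re → s.re ≤ b →
      ‖G2p T s * mellin Φ (-s)‖ ≤ C / (1 + |s.im|) ^ 4 ∧
      ‖G2m T s * mellin Φ (-s)‖ ≤ C / (1 + |s.im|) ^ 4 := by
  obtain ⟨C, hC0, N, hC⟩ := exists_norm_G2_le T ha b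
  obtain ⟨M, hM0, hM⟩ := hΦ.exists_norm_mellin_le_div (-b) (-a) (N + 4)
  refine ⟨C * M, by positivity, fun s h1 h2 => ?_⟩
  obtain ⟨e1, e2⟩ := hC s h1 h2
  have e3 := hM (-s) (by simpa) (by simpa)
  rw [neg_im, abs_neg] at e3
  have e4 : C * (1 + |s.im|) ^ N * (M / (1 + |s.im|) ^ (N + 4)) = C * M / (1 + |s.im|) ^ 4 := by
    have : (1 + |s.im|) ≠ 0 := by positivity
    rw [pow_add]; field_simp
  rw [norm_mul, norm_mul, ← e4]
  constructor <;> gcongr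

/-- Independence of the line of integration for the kernels of the dual side. -/
lemma VI_eq_VI {G : ℂ → ℂ} {C a b x : ℝ} (hΦ : IsTest Φ) (hab : a ≤ b) (hx : 0 < x)
    (hG : ∀ s : ℂ, a ≤ s.re → DifferentiableAt ℂ G s)
    (hC : ∀ s : ℂ, a ≤ s.re → s.re ≤ b → ‖G s * mellin Φ (-s)‖ ≤ C / (1 + |s.im|) ^ 4) :
    VI a (fun s => G s * mellinT Φ (-s) * (x : ℂ) ^ (-s)) =
      VI b (fun s => G s * mellinT Φ (-s) * (x : ℂ) ^ (-s)) := by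
  simp only [VI, mellinT_eq_mellin]
  congr 1
  have hx0 : (x : ℂ) ≠ 0 := ofReal_ne_zero.2 hx.ne'
  refine integral_vertical_eq (f := fun s => G s * mellin Φ (-s) * (x : ℂ) ^ (-s))
    (C := |C| * (x ^ (-a) + x ^ (-b))) hab (fun s h1 h2 => ?_) (fun s h1 h2 => ?_)
  · exact ((hG s h1).mul ((hΦ.differentiable_mellin (-s)).comp s (by fun_prop))).mul
      ((by fun_prop : DifferentiableAt ℂ (fun s : ℂ => -s) s).const_cpow (Or.inl hx0))
  · rw [norm_mul, norm_cpow_eq_rpow_re_of_pos hx, mul_comm |C|, mul_div_assoc, mul_comm]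
    have e1 : x ^ (-s).re ≤ x ^ (-a) + x ^ (-b) := by
      have p1 : 0 < x ^ (-a) := by positivity
      have p2 : 0 < x ^ (-b) := by positivity
      rcases le_total 1 x with h | h
      · have := Real.rpow_le_rpow_of_exponent_le h (by simpa : (-s).re ≤ -a); linarith
      · have := Real.rpow_le_rpow_of_exponent_ge hx h (by simpa : -b ≤ (-s).re); linarith
    have e2 : C / (1 + |s.im|) ^ 4 ≤ |C| / (1 + s.im ^ 2) := by
      have h1 : (1 : ℝ) ≤ (1 + |s.im|) ^ 2 := one_le_pow₀ (by linarith [abs_nonneg s.im])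
      have h2 : 1 + s.im ^ 2 ≤ (1 + |s.im|) ^ 2 := by
        nlinarith [sq_abs s.im, abs_nonneg s.im]
      exact div_le_div₀ (abs_nonneg _) (le_abs_self _) (by positivity) (by nlinarith)
    exact mul_le_mul e1 ((hC s h1 h2).trans e2) (norm_nonneg _) (by positivity)

lemma VI_eq_VI_of_pos {G : ℂ → ℂ} {σ σ' x : ℝ} (hΦ : IsTest Φ) (hσ : 0 < σ) (hσ' : 0 < σ')
    (hx : 0 < x) (hG : ∀ s : ℂ, 0 < s.re → DifferentiableAt ℂ G s)
    (hC : ∀ a b : ℝ, 0 < a → ∃ C : ℝ, ∀ s : ℂ, a ≤ s.re → s.re ≤ b →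
      ‖G s * mellin Φ (-s)‖ ≤ C / (1 + |s.im|) ^ 4) :
    VI σ (fun s => G s * mellinT Φ (-s) * (x : ℂ) ^ (-s)) =
      VI σ' (fun s => G s * mellinT Φ (-s) * (x : ℂ) ^ (-s)) := by
  rcases le_total σ σ' with h | h
  · obtain ⟨C, hC⟩ := hC σ σ' hσ
    exact VI_eq_VI hΦ h hx (fun s hs => hG s (hσ.trans_le hs)) hC
  · obtain ⟨C, hC⟩ := hC σ' σ hσ'
    exact (VI_eq_VI hΦ h hx (fun s hs => hG s (hσ'.trans_le hs)) hC).symm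

lemma checkPlus_eq (hΦ : IsTest Φ) {σ σ' x : ℝ} (hσ : 0 < σ) (hσ' : 0 < σ') (hx : 0 < x) (T : ℝ) :
    checkPlus Φ σ x T = checkPlus Φ σ' x T :=
  VI_eq_VI_of_pos hΦ hσ hσ' hx (fun _ => differentiableAt_G2p) fun a b ha => by
    obtain ⟨C, -, hC⟩ := exists_norm_G2_mul_mellin_le hΦ T ha b
    exact ⟨C, fun s h1 h2 => (hC s h1 h2).1⟩

lemma checkMinus_eq (hΦ : IsTest Φ) {σ σ' x : ℝ} (hσ : 0 < σ) (hσ' : 0 < σ') (hx : 0 < x) (T : ℝ) :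
    checkMinus Φ σ x T = checkMinus Φ σ' x T :=
  VI_eq_VI_of_pos hΦ hσ hσ' hx (fun _ => differentiableAt_G2m) fun a b ha => by
    obtain ⟨C, -, hC⟩ := exists_norm_G2_mul_mellin_le hΦ T ha b
    exact ⟨C, fun s h1 h2 => (hC s h1 h2).2⟩

end Kernels

section Summation

variable {c : ℕ} [NeZero c] {Φ : ℝ → ℂ}

/-- The coefficients `τ(n,2T) e(un/c)` of the Estermann function. -/
noncomputable def tw (u : ZMod c) (T : ℝ) (n : ℕ) : ℂ := tauT n T * ZMod.stdAddChar (u * (n : ZMod c))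

lemma hasSum_est (u : ZMod c) (T : ℝ) {s : ℂ} (hs : 1 < s.re) :
    HasSum (LSeries.term (tw u T) s) (est u T s) := LSeriesHasSum_est u T hs

lemma differentiableAt_est (u : ZMod c) (T : ℝ) {s : ℂ} (hs : 1 < s.re) :
    DifferentiableAt ℂ (est u T) s := by
  unfold est
  refine DifferentiableAt.fun_sum fun v _ => DifferentiableAt.fun_mul ?_ ?_
  · refine (ZMod.differentiableAt_LFunction _ _ (Or.inl ?_)).comp s (by fun_prop)
    exact fun h => by simpa [hs.ne'] using congrArg re h
  · refine (ZMod.differentiableAt_LFunction _ _ (Or.inl ?_)).comp s (by fun_prop)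
    exact fun h => by simpa [hs.ne'] using congrArg re h

lemma norm_term_eq_of_re (f : ℕ → ℂ) {s : ℂ} {σ : ℝ} (hs : s.re = σ) (n : ℕ) :
    ‖LSeries.term f s n‖ = ‖LSeries.term f (σ : ℂ) n‖ := by
  rw [LSeries.norm_term_eq, LSeries.norm_term_eq, hs, ofReal_re]

lemma summable_norm_term (u : ZMod c) (T : ℝ) {σ : ℝ} (hσ : 1 < σ) :
    Summable fun n => ‖LSeries.term (tw u T) (σ : ℂ) n‖ :=
  (hasSum_est u T (s := σ) (by simpa)).summable.norm

lemma exists_norm_est_le (u : ZMod c) (T : ℝ) {σ : ℝ} (hσ : 1 < σ) :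
    ∃ B : ℝ, 0 ≤ B ∧ ∀ s : ℂ, s.re = σ → ‖est u T s‖ ≤ B := by
  refine ⟨∑' n, ‖LSeries.term (tw u T) (σ : ℂ) n‖, tsum_nonneg fun _ => norm_nonneg _,
    fun s hs => ?_⟩
  rw [← (hasSum_est u T (s := s) (by rwa [hs])).tsum_eq]
  refine (norm_tsum_le_tsum_norm ?_).trans_eq ?_ <;> simp only [norm_term_eq_of_re _ hs]
  exact summable_norm_term u T hσ

lemma integrable_and_hasSum_integral_mul_term (u : ZMod c) (T : ℝ) {σ C : ℝ} (hσ : 1 < σ) {F : ℂ → ℂ}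
    (hF : Continuous fun y : ℝ => F (σ + y * I))
    (hC : ∀ y : ℝ, ‖F (σ + y * I)‖ ≤ C / (1 + y ^ 2)) :
    Integrable (fun y : ℝ => F (σ + y * I) * est u T (σ + y * I)) ∧
      HasSum (fun n => ∫ y : ℝ, F (σ + y * I) * LSeries.term (tw u T) (σ + y * I) n)
        (∫ y : ℝ, F (σ + y * I) * est u T (σ + y * I)) := by
  have hre : ∀ y : ℝ, (σ + y * I : ℂ).re = σ := by simp
  have hint : Integrable (fun y : ℝ => F (σ + y * I)) :=
    (integrable_const_div_one_add_sq C).mono' hF.aestronglyMeasurable (ae_of_all _ hC)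
  have hcont : ∀ n, Continuous fun y : ℝ => LSeries.term (tw u T) (σ + y * I) n := by
    intro n
    rcases eq_or_ne n 0 with rfl | hn
    · simpa using continuous_const
    · have hn' : (n : ℂ) ≠ 0 := Nat.cast_ne_zero.2 hn
      simp only [LSeries.term_of_ne_zero hn]
      refine continuous_const.div ?_ fun y => by simp [cpow_eq_zero_iff, hn]
      exact (by fun_prop : Continuous fun y : ℝ => (σ + y * I : ℂ)).const_cpow (Or.inl hn')
  have hnorm : ∀ n (y : ℝ), ‖F (σ + y * I) * LSeries.term (tw u T) (σ + y * I) n‖ =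
      ‖F (σ + y * I)‖ * ‖LSeries.term (tw u T) (σ : ℂ) n‖ := by
    intro n y
    rw [norm_mul, norm_term_eq_of_re _ (hre y)]
  obtain ⟨B, -, hB⟩ := exists_norm_est_le u T hσ
  refine ⟨hint.mul_bdd (c := B) (Continuous.aestronglyMeasurable ?_) (ae_of_all _ fun y => hB _ (hre y)), ?_⟩
  · exact continuous_iff_continuousAt.2 fun y => ContinuousAt.comp
      (f := fun y : ℝ => (σ + y * I : ℂ)) (differentiableAt_est u T (by rwa [hre])).continuousAt
      (by fun_prop)
  have key := hasSum_integral_of_summable_integral_norm (μ := volume)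
    (F := fun n (y : ℝ) => F (σ + y * I) * LSeries.term (tw u T) (σ + y * I) n) ?_ ?_
  · have h : ∀ y : ℝ, ∑' n, F (σ + y * I) * LSeries.term (tw u T) (σ + y * I) n =
        F (σ + y * I) * est u T (σ + y * I) := fun y => by
      rw [tsum_mul_left, (hasSum_est u T (by rwa [hre])).tsum_eq]
    simpa only [h] using key
  · intro n
    refine (hint.norm.mul_const ‖LSeries.term (tw u T) (σ : ℂ) n‖).mono'
      (hF.mul (hcont n)).aestronglyMeasurable (ae_of_all _ fun y => (hnorm n y).le)
  · simp only [hnorm, integral_mul_const]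
    exact (summable_norm_term u T hσ).mul_left _

lemma norm_natCast_cpow_vertical {w : ℂ} (hw : w.re = 2) :
    ‖(c : ℂ) ^ (2 * w - 1)‖ = (c : ℝ) ^ (3 : ℝ) := by
  rw [norm_natCast_cpow_of_pos (NeZero.pos c)]
  congr 1; simp [hw]; norm_num

lemma exists_norm_mellin_mul_est_le (hΦ : IsTest Φ) (u : (ZMod c)ˣ) (T : ℝ) :
    ∃ C : ℝ, 0 ≤ C ∧ ∀ s : ℂ, s.re = -2 ∨ s.re = 1 →
      ‖mellin Φ s * est (u : ZMod c) T (1 + s)‖ ≤ C / (1 + |s.im|) ^ 4 := by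
  obtain ⟨C, hC0, hC⟩ := exists_norm_G2_mul_mellin_le hΦ T two_pos 2
  obtain ⟨M, hM0, hM⟩ := hΦ.exists_norm_mellin_le_div 1 1 4
  obtain ⟨B, hB0, hB⟩ := exists_norm_est_le (u : ZMod c) T one_lt_two
  obtain ⟨B1, hB10, hB1⟩ := exists_norm_est_le (↑u⁻¹ : ZMod c) T one_lt_two
  obtain ⟨B2, hB20, hB2⟩ := exists_norm_est_le (-(↑u⁻¹ : ZMod c)) T one_lt_two
  refine ⟨(c : ℝ) ^ (3 : ℝ) * (C * B1 + C * B2) + M * B, by positivity, fun s hs => ?_⟩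
  rcases hs with hs | hs
  · set w := -s with hw
    have hwre : w.re = 2 := by simp [hw, hs]
    have him : |w.im| = |s.im| := by simp [hw]
    have hC' := hC w hwre.ge hwre.le
    rw [show s = -w by simp [hw], ← sub_eq_add_neg, est_one_sub u T (by rw [hwre]; norm_num),
      neg_im, abs_neg]
    calc _ = ‖(c : ℂ) ^ (2 * w - 1) * (G2p T w * mellin Φ (-w) * est (↑u⁻¹ : ZMod c) T w +
          G2m T w * mellin Φ (-w) * est (-(↑u⁻¹ : ZMod c)) T w)‖ := by congr 1; ring
      _ ≤ (c : ℝ) ^ (3 : ℝ) * (C / (1 + |w.im|) ^ 4 * B1 + C / (1 + |w.im|) ^ 4 * B2) := by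
        rw [norm_mul, norm_natCast_cpow_vertical hwre]
        refine mul_le_mul_of_nonneg_left ((norm_add_le _ _).trans ?_) (by positivity)
        rw [norm_mul _ (est _ _ _), norm_mul _ (est _ _ _)]
        gcongr
        exacts [hC'.1, hB1 w hwre, hC'.2, hB2 w hwre]
      _ = ((c : ℝ) ^ (3 : ℝ) * (C * B1 + C * B2)) / (1 + |w.im|) ^ 4 := by ring
      _ ≤ _ := by gcongr; simp; positivity
  · have e1 := hM s hs.ge hs.le
    have e2 := hB (1 + s) (by simp [hs]; norm_num)
    calc _ ≤ M / (1 + |s.im|) ^ 4 * B := by rw [norm_mul]; gcongr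
      _ = M * B / (1 + |s.im|) ^ 4 := by ring
      _ ≤ _ := by gcongr; simp; positivity

lemma norm_sub_le_mul {s : ℂ} {t : ℝ} (h1 : -2 ≤ s.re) (h2 : s.re ≤ 2) :
    ‖s + t * I‖ ≤ (2 + |t|) * (1 + |s.im|) := by
  have e1 := norm_le_abs_re_add_abs_im (s + t * I)
  have e2 : |(s + t * I).re| ≤ 2 := by rw [abs_le]; simpa using ⟨h1, h2⟩
  have e3 : |(s + t * I).im| ≤ |s.im| + |t| := by simpa using abs_add_le s.im t
  nlinarith [abs_nonneg s.im, abs_nonneg t]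

lemma exists_norm_mellin_mul_estStar_le (hΦ : IsTest Φ) (u : (ZMod c)ˣ) (T : ℝ) :
    ∃ C : ℝ, ∀ s : ℂ, -2 ≤ s.re → s.re ≤ 1 →
      ‖mellin Φ s * estStar (u : ZMod c) T s‖ ≤ C / (1 + s.im ^ 2) := by
  obtain ⟨M0, hM00, hM0⟩ := hΦ.exists_norm_mellin_le_div (-2) 1 0
  obtain ⟨M, hM⟩ := exists_norm_estStar_le (u : ZMod c) T
  obtain ⟨C, hC0, hC⟩ := exists_norm_mellin_mul_est_le hΦ u T
  have hedge : ∀ s : ℂ, s.re = -2 ∨ s.re = 1 → ‖mellin Φ s * estStar (u : ZMod c) T s‖ ≤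
      C * (2 + |2 * T|) ^ 2 / (1 + s.im ^ 2) := by
    intro s hs
    have hre : s.re ≠ 0 := by rcases hs with h | h <;> rw [h] <;> norm_num
    have hb : -2 ≤ s.re ∧ s.re ≤ 2 := by rcases hs with h | h <;> rw [h] <;> norm_num
    rw [estStar_eq _ _ (by rintro rfl; simp at hre) (by rintro rfl; simp at hre)]
    have e1 := norm_sub_le_mul (t := 2 * T) hb.1 hb.2
    have e2 := norm_sub_le_mul (t := -(2 * T)) hb.1 hb.2
    rw [abs_neg] at e2
    push_cast at e1 e2
    rw [neg_mul, ← sub_eq_add_neg] at e2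
    have e3 := hC s hs
    calc _ = ‖mellin Φ s * est (u : ZMod c) T (1 + s)‖ * (‖s - 2 * T * I‖ * ‖s + 2 * T * I‖) := by
          rw [← norm_mul, ← norm_mul]; congr 1; ring
      _ ≤ C / (1 + |s.im|) ^ 4 * (((2 + |2 * T|) * (1 + |s.im|)) *
          ((2 + |2 * T|) * (1 + |s.im|))) := by gcongr
      _ = C * (2 + |2 * T|) ^ 2 * (1 / (1 + |s.im|) ^ 2) := by
          have : 1 + |s.im| ≠ 0 := by positivity
          field_simp
      _ ≤ C * (2 + |2 * T|) ^ 2 * (1 / (1 + s.im ^ 2)) :=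
          mul_le_mul_of_nonneg_left (one_div_one_add_abs_sq_le _) (by positivity)
      _ = _ := by ring
  refine exists_bound_of_edges (K := 2 * (Real.pi + 1)) (M := M0 * M)
    (hΦ.differentiable_mellin.mul (differentiable_estStar _ T)) (by norm_num)
    (by positivity) (fun s h1 h2 _ => ?_) (fun s h => hedge s (Or.inl h))
    (fun s h => hedge s (Or.inr h))
  have e1 := hM0 s h1 h2
  rw [pow_zero, div_one] at e1
  change ‖mellin Φ s * estStar _ T s‖ ≤ _
  rw [norm_mul, mul_assoc]
  exact mul_le_mul e1 (hM s h1 h2) (norm_nonneg _) hM00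

lemma four_mul_integral_mellin_mul_est (hΦ : IsTest Φ) (u : (ZMod c)ˣ) (T : ℝ)
    {σ : ℝ} (h1 : -2 ≤ σ) (h2 : σ ≤ 1) (h3 : 1 ≤ |σ|) :
    4 * T * I * ∫ y : ℝ, mellin Φ (σ + y * I) * est (u : ZMod c) T (1 + (σ + y * I)) =
      (∫ y : ℝ, mellin Φ (σ + y * I) * estStar (u : ZMod c) T (σ + y * I) /
        (σ + y * I - 2 * T * I)) -
      ∫ y : ℝ, mellin Φ (σ + y * I) * estStar (u : ZMod c) T (σ + y * I) /
        (σ + y * I - -(2 * T * I)) := by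
  obtain ⟨C, hC⟩ := exists_norm_mellin_mul_estStar_le hΦ u T
  have hσ : σ ≠ 0 := by rintro rfl; norm_num at h3
  have hlow : ∀ (p : ℂ) (y : ℝ), p.re = 0 → 1 ≤ ‖(σ + y * I : ℂ) - p‖ := fun p y hp =>
    h3.trans (by simpa [hp] using abs_re_le_norm ((σ + y * I : ℂ) - p))
  have hint : ∀ p : ℂ, p.re = 0 → Integrable fun y : ℝ =>
      mellin Φ (σ + y * I) * estStar (u : ZMod c) T (σ + y * I) / (σ + y * I - p) := by
    intro p hp
    refine (integrable_const_div_one_add_sq C).mono' (Continuous.aestronglyMeasurable ?_)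
      (ae_of_all _ fun y => ?_)
    · have hl : Continuous fun y : ℝ => (σ + y * I : ℂ) := by fun_prop
      refine ((hΦ.differentiable_mellin.continuous.comp hl).mul
        ((differentiable_estStar _ T).continuous.comp hl)).div (by fun_prop) fun y h => ?_
      have := hlow p y hp
      rw [h] at this; norm_num at this
    · have e := hC (σ + y * I) (by simpa) (by simpa)
      rw [norm_div]
      refine (div_le_self (norm_nonneg _) (hlow p y hp)).trans ?_
      simpa using e
  rw [← integral_sub (hint _ (by simp)) (hint _ (by simp)), ← integral_const_mul]
  refine integral_congr_ae (ae_of_all _ fun y => ?_)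
  have hne : ∀ p : ℂ, p.re = 0 → (σ + y * I : ℂ) ≠ p := by
    rintro p hp rfl; simp [hσ] at hp
  have n1 : (σ + y * I : ℂ) ≠ 2 * T * I := hne _ (by simp)
  have n2 : (σ + y * I : ℂ) ≠ -(2 * T * I) := hne _ (by simp)
  have n1' := sub_ne_zero.2 n1
  have n2' := sub_ne_zero.2 n2
  simp only
  rw [estStar_eq _ _ n1 n2]
  generalize (σ + y * I : ℂ) = s at *
  rw [div_sub_div _ _ n1' n2', eq_div_iff (mul_ne_zero n1' n2')]
  ring

/-- The contour shift for the Estermann function, with its two residues. -/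
lemma integral_mellin_mul_est_eq (hΦ : IsTest Φ) (u : (ZMod c)ˣ) {T : ℝ} (hT : T ≠ 0) :
    ∫ y : ℝ, mellin Φ ((1 : ℝ) + y * I) * est (u : ZMod c) T (1 + ((1 : ℝ) + y * I)) =
      (∫ y : ℝ, mellin Φ ((-2 : ℝ) + y * I) * est (u : ZMod c) T (1 + ((-2 : ℝ) + y * I))) +
      2 * Real.pi * (riemannZeta (1 + 4 * T * I) * (c : ℂ) ^ (-1 - 4 * T * I) *
          mellin Φ (2 * T * I) +
        riemannZeta (1 - 4 * T * I) * (c : ℂ) ^ (-1 + 4 * T * I) * mellin Φ (-(2 * T * I))) := by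
  obtain ⟨C, hC⟩ := exists_norm_mellin_mul_estStar_le hΦ u T
  have hd : Differentiable ℂ fun s => mellin Φ s * estStar (u : ZMod c) T s :=
    hΦ.differentiable_mellin.mul (differentiable_estStar _ T)
  have r1 := integral_vertical_sub_eq_residue (p := 2 * T * I) hd (by simp) (by simp) hC
  have r2 := integral_vertical_sub_eq_residue (p := -(2 * T * I)) hd (by simp) (by simp) hC
  have l1 := four_mul_integral_mellin_mul_est hΦ u T (σ := 1) (by norm_num) (by norm_num)
    (by norm_num)
  have l2 := four_mul_integral_mellin_mul_est hΦ u T (σ := -2) (by norm_num) (by norm_num)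
    (by norm_num)
  simp only [estStar_two_mul_I u hT, estStar_neg_two_mul_I u hT] at r1 r2
  have h0 : 4 * T * I ≠ 0 := by simp [hT]
  apply mul_left_cancel₀ h0
  linear_combination l1 - l2 + r1 - r2

lemma tw_zero (u : ZMod c) (T : ℝ) : tw u T 0 = 0 := by simp [tw, tauT]

lemma integral_mellin_mul_cpow (hΦ : IsTest Φ) {x : ℝ} (hx : 0 < x) (σ : ℝ) :
    ∫ y : ℝ, mellin Φ (σ + y * I) * (x : ℂ) ^ (-(σ + y * I : ℂ)) = 2 * Real.pi * Φ x := by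
  obtain ⟨C, hC0, hC⟩ := hΦ.exists_norm_mellin_le_div σ σ 2
  have hint : VerticalIntegrable (mellin Φ) σ := by
    refine integrable_vertical (a := σ) (b := σ) (C := C) le_rfl le_rfl
      (fun s _ _ => hΦ.differentiable_mellin s) fun s h1 h2 => (hC s h1 h2).trans ?_
    rw [div_eq_mul_one_div, div_eq_mul_one_div C]
    exact mul_le_mul_of_nonneg_left (one_div_one_add_abs_sq_le _) hC0
  have key := mellinInv_mellin_eq σ Φ hx (hΦ.mellinConvergent _) hint
    hΦ.contDiff.continuous.continuousAt
  rw [mellinInv, real_smul] at key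
  rw [← key]
  have hp : (Real.pi : ℂ) ≠ 0 := ofReal_ne_zero.2 Real.pi_ne_zero
  have h1 : ∀ J : ℂ, J = 2 * Real.pi * (((1 / (2 * Real.pi) : ℝ) : ℂ) * J) := by
    intro J; push_cast; field_simp
  simp only [smul_eq_mul, mul_comm (mellin Φ _)]
  exact h1 _

/-- The sum of the left-hand side as a vertical integral. -/
lemma hasSum_tw_div_mul (hΦ : IsTest Φ) (u : ZMod c) (T : ℝ) :
    HasSum (fun n : ℕ => 2 * Real.pi * (tw u T n / n * Φ n))
      (∫ y : ℝ, mellin Φ ((1 : ℝ) + y * I) * est u T (1 + ((1 : ℝ) + y * I))) := by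
  obtain ⟨C, hC0, hC⟩ := hΦ.exists_norm_mellin_le_div 1 1 2
  have hs : ∀ y : ℝ, ((2 : ℝ) + y * I : ℂ) - 1 = (1 : ℝ) + y * I := by
    intro y; push_cast; ring
  have hs' : ∀ y : ℝ, ((2 : ℝ) + y * I : ℂ) = 1 + ((1 : ℝ) + y * I) := by
    intro y; push_cast; ring
  have key := (integrable_and_hasSum_integral_mul_term u T (σ := 2) (C := C) (by norm_num)
    (F := fun s => mellin Φ (s - 1)) ?_ ?_).2
  · simp only [hs] at key
    simp only [hs'] at key
    refine Eq.subst (motive := fun f => HasSum f _) (funext fun n => ?_) key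
    rcases eq_or_ne n 0 with rfl | hn
    · simp [tw_zero]
    have hn' : (n : ℂ) ≠ 0 := Nat.cast_ne_zero.2 hn
    have hi := integral_mellin_mul_cpow hΦ (x := n) (by positivity) 1
    rw [ofReal_natCast] at hi
    calc _ = ∫ y : ℝ, tw u T n / n * (mellin Φ ((1 : ℝ) + y * I) *
          (n : ℂ) ^ (-((1 : ℝ) + y * I : ℂ))) := by
          refine integral_congr_ae (ae_of_all _ fun y => ?_)
          simp only
          rw [LSeries.term_of_ne_zero hn, cpow_add _ _ hn', cpow_one, cpow_neg]
          have : (n : ℂ) ^ ((1 : ℝ) + y * I : ℂ) ≠ 0 := by simp [cpow_eq_zero_iff, hn]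
          field_simp
      _ = _ := by rw [integral_const_mul, hi]; ring
  · exact hΦ.differentiable_mellin.continuous.comp (by fun_prop)
  · intro y
    simp only [hs]
    refine (hC _ (by simp) (by simp)).trans ?_
    rw [div_eq_mul_one_div, div_eq_mul_one_div C]
    simpa using mul_le_mul_of_nonneg_left (one_div_one_add_abs_sq_le y) hC0

lemma natCast_cpow_mul_natCast_cpow (n : ℕ) {w : ℂ} :
    (c : ℂ) ^ (2 * w - 1) * (n : ℂ) ^ (-w) = 1 / c * (((n : ℝ) / (c : ℝ) ^ 2 : ℝ) : ℂ) ^ (-w) := by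
  have hc : (c : ℂ) ≠ 0 := Nat.cast_ne_zero.2 (NeZero.ne c)
  have hcR : (c : ℝ) ≠ 0 := Nat.cast_ne_zero.2 (NeZero.ne c)
  have e1 : (n : ℂ) = (((n : ℝ) / (c : ℝ) ^ 2 : ℝ) : ℂ) * (((c : ℝ) * (c : ℝ) : ℝ) : ℂ) := by
    push_cast; field_simp
  have e2 := mul_cpow_ofReal_nonneg (a := (n : ℝ) / (c : ℝ) ^ 2) (b := (c : ℝ) * c)
    (by positivity) (by positivity) (-w)
  have e3 := mul_cpow_ofReal_nonneg (a := (c : ℝ)) (b := (c : ℝ))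
    (by positivity) (by positivity) (-w)
  rw [← ofReal_mul, ofReal_natCast] at e3
  rw [e1, e2, e3, show 2 * w - 1 = w + w - 1 by ring, cpow_sub _ _ hc, cpow_add _ _ hc, cpow_one,
    cpow_neg (c : ℂ)]
  have : (c : ℂ) ^ w ≠ 0 := by simp [cpow_eq_zero_iff, hc]
  field_simp

lemma integrable_and_hasSum_tw_mul_VI (hΦ : IsTest Φ) (u : ZMod c) (T : ℝ) {G : ℂ → ℂ} {C : ℝ}
    (hG : ∀ s : ℂ, 0 < s.re → DifferentiableAt ℂ G s)
    (hC : ∀ s : ℂ, 2 ≤ s.re → s.re ≤ 2 → ‖G s * mellin Φ (-s)‖ ≤ C / (1 + |s.im|) ^ 4) :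
    Integrable (fun y : ℝ => (c : ℂ) ^ (2 * ((2 : ℝ) + y * I : ℂ) - 1) * (G ((2 : ℝ) + y * I) *
        mellin Φ (-((2 : ℝ) + y * I))) * est u T ((2 : ℝ) + y * I)) ∧
    HasSum (fun n : ℕ => 2 * Real.pi * (1 / c * (tw u T n *
        VI 2 (fun s => G s * mellinT Φ (-s) * (((n : ℝ) / (c : ℝ) ^ 2 : ℝ) : ℂ) ^ (-s)))))
      (∫ y : ℝ, (c : ℂ) ^ (2 * ((2 : ℝ) + y * I : ℂ) - 1) * (G ((2 : ℝ) + y * I) *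
        mellin Φ (-((2 : ℝ) + y * I))) * est u T ((2 : ℝ) + y * I)) := by
  have key := integrable_and_hasSum_integral_mul_term u T (σ := 2) (C := (c : ℝ) ^ (3 : ℝ) * |C|) (by norm_num)
    (F := fun s => (c : ℂ) ^ (2 * s - 1) * (G s * mellin Φ (-s))) ?_ ?_
  · refine ⟨key.1, Eq.subst (motive := fun f => HasSum f _) (funext fun n => ?_) key.2⟩
    rcases eq_or_ne n 0 with rfl | hn
    · simp [tw_zero]
    have hp : (Real.pi : ℂ) ≠ 0 := ofReal_ne_zero.2 Real.pi_ne_zero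
    have h2 : ∀ J : ℂ, 1 / c * tw u T n * J =
        2 * Real.pi * (1 / c * (tw u T n * (((1 / (2 * Real.pi) : ℝ) : ℂ) * J))) := by
      intro J; push_cast; field_simp
    simp only [VI, mellinT_eq_mellin]
    calc _ = ∫ y : ℝ, 1 / c * tw u T n * (G ((2 : ℝ) + y * I) *
          mellin Φ (-((2 : ℝ) + y * I)) *
          (((n : ℝ) / (c : ℝ) ^ 2 : ℝ) : ℂ) ^ (-((2 : ℝ) + y * I : ℂ))) := by
          refine integral_congr_ae (ae_of_all _ fun y => ?_)
          have h1 := natCast_cpow_mul_natCast_cpow (c := c) n (w := (2 : ℝ) + y * I)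
          simp only
          rw [LSeries.term_of_ne_zero hn, div_eq_mul_inv, ← cpow_neg]
          linear_combination G ((2 : ℝ) + y * I) * mellin Φ (-((2 : ℝ) + y * I)) * tw u T n * h1
      _ = _ := by rw [integral_const_mul]; exact h2 _
  · have hl : Continuous fun y : ℝ => ((2 : ℝ) + y * I : ℂ) := by fun_prop
    refine Continuous.mul ?_ (Continuous.mul ?_ (hΦ.differentiable_mellin.continuous.comp hl.neg))
    · exact Continuous.const_cpow (by fun_prop) (Or.inl (Nat.cast_ne_zero.2 (NeZero.ne c)))
    · refine continuous_iff_continuousAt.2 fun y => ?_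
      exact ContinuousAt.comp (f := fun y : ℝ => ((2 : ℝ) + y * I : ℂ))
        (hG _ (by simp)).continuousAt hl.continuousAt
  · intro y
    rw [norm_mul, norm_natCast_cpow_vertical (by simp), mul_div_assoc]
    refine mul_le_mul_of_nonneg_left ((hC _ (by simp) (by simp)).trans ?_) (by positivity)
    have h1 : (1 : ℝ) ≤ (1 + |y|) ^ 2 := one_le_pow₀ (by linarith [abs_nonneg y])
    have h2 : 1 + y ^ 2 ≤ (1 + |y|) ^ 2 := by nlinarith [sq_abs y, abs_nonneg y]
    have h3 : ((2 : ℝ) + y * I : ℂ).im = y := by simp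
    rw [h3]
    exact div_le_div₀ (abs_nonneg _) (le_abs_self _) (by positivity) (by nlinarith)

/-- The dual side of the summation formula, on the line `Re s = 2`. -/
lemma hasSum_dual (hΦ : IsTest Φ) (u : (ZMod c)ˣ) (T : ℝ) :
    HasSum (fun n : ℕ => 2 * Real.pi * (1 / c *
        (tw (↑u⁻¹ : ZMod c) T n * checkPlus Φ 2 ((n : ℝ) / (c : ℝ) ^ 2) T +
          tw (-(↑u⁻¹ : ZMod c)) T n * checkMinus Φ 2 ((n : ℝ) / (c : ℝ) ^ 2) T)))
      (∫ y : ℝ, mellin Φ ((-2 : ℝ) + y * I) * est (u : ZMod c) T (1 + ((-2 : ℝ) + y * I))) := by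
  obtain ⟨C, -, hC⟩ := exists_norm_G2_mul_mellin_le hΦ T two_pos 2
  obtain ⟨ip, sp⟩ := integrable_and_hasSum_tw_mul_VI hΦ (↑u⁻¹ : ZMod c) T (G := G2p T)
    (fun _ => differentiableAt_G2p) (fun s h1 h2 => (hC s h1 h2).1)
  obtain ⟨im, sm⟩ := integrable_and_hasSum_tw_mul_VI hΦ (-(↑u⁻¹ : ZMod c)) T (G := G2m T)
    (fun _ => differentiableAt_G2m) (fun s h1 h2 => (hC s h1 h2).2)
  have key := sp.add sm
  rw [← integral_add ip im] at key
  rw [← integral_neg_eq_self]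
  refine Eq.subst (motive := fun J => HasSum _ J) (integral_congr_ae (ae_of_all _ fun y => ?_))
    (Eq.subst (motive := fun f => HasSum f _) (funext fun n => ?_) key)
  · simp only
    rw [show (((-2 : ℝ) : ℂ) + ((-y : ℝ) : ℂ) * I) = -((2 : ℝ) + y * I) by push_cast; ring,
      ← sub_eq_add_neg, est_one_sub u T (by simp)]
    ring
  · simp only [checkPlus, checkMinus]
    ring

/-- The summation formula as an identity of sums over the natural numbers. -/
lemma tsum_tw_div_mul_eq (hΦ : IsTest Φ) (u : (ZMod c)ˣ) {T : ℝ} (hT : T ≠ 0) :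
    ∑' n : ℕ, tw (u : ZMod c) T n / n * Φ n =
      riemannZeta (1 + 4 * T * I) * (c : ℂ) ^ (-1 - 4 * T * I) * mellin Φ (2 * T * I) +
      riemannZeta (1 - 4 * T * I) * (c : ℂ) ^ (-1 + 4 * T * I) * mellin Φ (-(2 * T * I)) +
      1 / c * ∑' n : ℕ,
        (tw (↑u⁻¹ : ZMod c) T n * checkPlus Φ 2 ((n : ℝ) / (c : ℝ) ^ 2) T +
          tw (-(↑u⁻¹ : ZMod c)) T n * checkMinus Φ 2 ((n : ℝ) / (c : ℝ) ^ 2) T) := by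
  have h1 := (hasSum_tw_div_mul hΦ (u : ZMod c) T).tsum_eq
  have h2 := (hasSum_dual hΦ u T).tsum_eq
  have hp : (2 * Real.pi : ℂ) ≠ 0 := by simp [Real.pi_ne_zero]
  rw [tsum_mul_left] at h1 h2
  rw [tsum_mul_left] at h2
  apply mul_left_cancel₀ hp
  rw [h1, integral_mellin_mul_est_eq hΦ u hT, ← h2]
  ring

lemma summable_tw_div_mul (hΦ : IsTest Φ) (u : ZMod c) (T : ℝ) :
    Summable fun n : ℕ => tw u T n / n * Φ n :=
  (summable_mul_left_iff (by simp [Real.pi_ne_zero])).1 (hasSum_tw_div_mul hΦ u T).summable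

lemma summable_dual (hΦ : IsTest Φ) (u : (ZMod c)ˣ) (T : ℝ) :
    Summable fun n : ℕ => tw (↑u⁻¹ : ZMod c) T n * checkPlus Φ 2 ((n : ℝ) / (c : ℝ) ^ 2) T +
          tw (-(↑u⁻¹ : ZMod c)) T n * checkMinus Φ 2 ((n : ℝ) / (c : ℝ) ^ 2) T := by
  have hp : (2 * Real.pi : ℂ) ≠ 0 := by simp [Real.pi_ne_zero]
  have hc : (1 / c : ℂ) ≠ 0 := one_div_ne_zero (Nat.cast_ne_zero.2 (NeZero.ne c))
  exact (summable_mul_left_iff hc).1 ((summable_mul_left_iff hp).1 (hasSum_dual hΦ u T).summable)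

lemma tw_intCast (k : ℤ) (T : ℝ) (n : ℕ) : tw (k : ZMod c) T n = tauT n T * e (n * k / c) := by
  have h1 : (k : ZMod c) * n = ((k * n : ℤ) : ZMod c) := by push_cast; rfl
  rw [tw, h1, ZMod.stdAddChar_coe, e]
  congr 2
  push_cast; ring

lemma hasSum_pnat_iff {f : ℕ → ℂ} (h0 : f 0 = 0) {a : ℂ} :
    HasSum (fun n : ℕ+ => f n) a ↔ HasSum f a :=
  PNat.coe_injective.hasSum_iff (f := f) fun n hn => by
    rcases Nat.eq_zero_or_pos n with rfl | h
    · exact h0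
    · exact absurd ⟨⟨n, h⟩, rfl⟩ hn

end Summation

end Voronoi

/-- Voronoi summation for `τ(m,2T)`. -/
theorem voronoi_tauT (Φ : ℝ → ℂ) (hΦ : ContDiff ℝ (⊤ : ℕ∞) Φ) (hcs : HasCompactSupport Φ)
    (hsupp : tsupport Φ ⊆ Ioi (0 : ℝ)) (T : ℝ) (hT : 0 < T) (c : ℕ) (hc : 0 < c)
    (h hbar : ℤ) (hcop : Int.gcd h (c : ℤ) = 1) (hinv : h * hbar ≡ 1 [ZMOD (c : ℤ)])
    (σ : ℝ) (hσ : 0 < σ) :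
    Summable (fun b : ℕ+ => tauT (b : ℕ) T *
      (e (((b : ℕ) : ℂ) * (hbar : ℂ) / (c : ℂ)) * checkPlus Φ σ (((b : ℕ) : ℝ) / (c : ℝ) ^ 2) T +
       e (-(((b : ℕ) : ℂ) * (hbar : ℂ)) / (c : ℂ)) *
         checkMinus Φ σ (((b : ℕ) : ℝ) / (c : ℝ) ^ 2) T)) ∧
    ∑' m : ℕ+, (tauT (m : ℕ) T / ((m : ℕ) : ℂ)) *
        e (((m : ℕ) : ℂ) * (h : ℂ) / (c : ℂ)) * Φ ((m : ℕ) : ℝ)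
      = riemannZeta (1 + 4 * T * Complex.I) * (c : ℂ) ^ (-1 - 4 * T * Complex.I) *
          (∫ x in Ioi (0 : ℝ), Φ x * (x : ℂ) ^ (2 * T * Complex.I - 1))
      + riemannZeta (1 - 4 * T * Complex.I) * (c : ℂ) ^ (-1 + 4 * T * Complex.I) *
          (∫ x in Ioi (0 : ℝ), Φ x * (x : ℂ) ^ (-(2 * T * Complex.I) - 1))
      + (1 / (c : ℂ)) * ∑' b : ℕ+, tauT (b : ℕ) T *
          (e (((b : ℕ) : ℂ) * (hbar : ℂ) / (c : ℂ)) *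
             checkPlus Φ σ (((b : ℕ) : ℝ) / (c : ℝ) ^ 2) T +
           e (-(((b : ℕ) : ℂ) * (hbar : ℂ)) / (c : ℂ)) *
             checkMinus Φ σ (((b : ℕ) : ℝ) / (c : ℝ) ^ 2) T) := by
  have : NeZero c := ⟨hc.ne'⟩
  have hΦ' : Voronoi.IsTest Φ := ⟨hΦ, hcs, hsupp⟩
  have hmul : (h : ZMod c) * (hbar : ZMod c) = 1 := by
    have := (ZMod.intCast_eq_intCast_iff _ _ c).2 hinv
    simpa using this
  set u : (ZMod c)ˣ := ⟨h, hbar, hmul, by rw [mul_comm, hmul]⟩ with hu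
  have hu1 : (u : ZMod c) = h := rfl
  have hu2 : (↑u⁻¹ : ZMod c) = hbar := rfl
  set D : ℕ → ℂ := fun n =>
    Voronoi.tw (↑u⁻¹ : ZMod c) T n * checkPlus Φ 2 ((n : ℝ) / (c : ℝ) ^ 2) T +
      Voronoi.tw (-(↑u⁻¹ : ZMod c)) T n * checkMinus Φ 2 ((n : ℝ) / (c : ℝ) ^ 2) T with hD
  have hDsum := (Voronoi.hasSum_pnat_iff (by simp [Voronoi.tw_zero])).2
    (Voronoi.summable_dual hΦ' u T).hasSum
  have hdual : (fun b : ℕ+ => tauT (b : ℕ) T *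
      (e (((b : ℕ) : ℂ) * (hbar : ℂ) / (c : ℂ)) * checkPlus Φ σ (((b : ℕ) : ℝ) / (c : ℝ) ^ 2) T +
       e (-(((b : ℕ) : ℂ) * (hbar : ℂ)) / (c : ℂ)) *
         checkMinus Φ σ (((b : ℕ) : ℝ) / (c : ℝ) ^ 2) T)) = fun b : ℕ+ => D b := by
    funext b
    have hx : (0 : ℝ) < ((b : ℕ) : ℝ) / (c : ℝ) ^ 2 := by positivity
    have hneg : -(↑u⁻¹ : ZMod c) = ((-hbar : ℤ) : ZMod c) := by rw [hu2, Int.cast_neg]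
    simp only [hD]
    rw [hneg, hu2, Voronoi.tw_intCast, Voronoi.tw_intCast,
      Voronoi.checkPlus_eq hΦ' hσ two_pos hx, Voronoi.checkMinus_eq hΦ' hσ two_pos hx,
      Int.cast_neg, mul_neg]
    ring
  have hleft : ∑' m : ℕ+, (tauT (m : ℕ) T / ((m : ℕ) : ℂ)) *
        e (((m : ℕ) : ℂ) * (h : ℂ) / (c : ℂ)) * Φ ((m : ℕ) : ℝ) =
      ∑' n : ℕ, Voronoi.tw (u : ZMod c) T n / n * Φ n := by
    have h1 := ((Voronoi.summable_tw_div_mul hΦ' (u : ZMod c) T).hasSum)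
    rw [← ((Voronoi.hasSum_pnat_iff (by simp [Voronoi.tw_zero])).2 h1).tsum_eq]
    refine tsum_congr fun m => ?_
    rw [hu1, Voronoi.tw_intCast]
    ring
  rw [hdual, hleft, Voronoi.tsum_tw_div_mul_eq hΦ' u hT.ne', hDsum.tsum_eq]
  refine ⟨hDsum.summable, ?_⟩
  rw [← Voronoi.mellinT_eq_mellin, ← Voronoi.mellinT_eq_mellin]
  rfl
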